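/- arXiv:1811.00618 — 2 statements merged into one kernel-verified Lean document; each statement's English description precedes it below -/
import Mathlib

section
/- Let p₁(·), p₂(·) : ℝⁿ → [1,∞) be measurable exponent functions with 1 < (pⱼ)₋ ≤ (pⱼ)₊ < ∞ and pⱼ(·) ∈ LH for j = 1,2, define p(·) by 1/p(x) = 1/p₁(x) + 1/p₂(x), and let w₁, w₂ be weights with w = w₁w₂. If (w₁,w₂,w) ∈ A_{p⃗(·)}, then the weights u(x) = w(x)^{p(x)}, σ₁(x) = w₁(x)^{−p₁'(x)}, and σ₂(x) = w₂(x)^{−p₂'(x)} all belong to the Muckenhoupt class A_∞. -/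
open MeasureTheory ENNReal Set

noncomputable section

/-- Euclidean space `ℝⁿ`. -/
abbrev Rn (n : ℕ) : Type := Fin n → ℝ

/-- A cube in `ℝⁿ` with sides parallel to the coordinate axes. -/
structure Cube (n : ℕ) : Type where
  base : Fin n → ℝ
  side : ℝ
  side_pos : 0 < side

namespace Cube

/-- The set of points of a cube. -/
def toSet {n : ℕ} (Q : Cube n) : Set (Rn n) :=
  {x | ∀ i, Q.base i ≤ x i ∧ x i < Q.base i + Q.side}

/-- The volume `|Q|` of a cube. -/
def vol {n : ℕ} (Q : Cube n) : ℝ≥0∞ := ENNReal.ofReal (Q.side ^ n)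

/-- Membership in the standard dyadic grid `𝒟₀`. -/
def IsDyadic {n : ℕ} (Q : Cube n) : Prop :=
  ∃ (k : ℤ) (j : Fin n → ℤ), Q.side = (2 : ℝ) ^ (-k) ∧
    ∀ i, Q.base i = (2 : ℝ) ^ (-k) * (j i : ℝ)

end Cube

/-- The modular associated to an extended-real-valued exponent `r(·)`:
`ρ(f/λ) = ∫_{r ≠ ∞} (f/λ)^{r(x)} dμ + ‖f/λ‖_{L^∞({r = ∞})}`. -/
def eModular {n : ℕ} (r : Rn n → ℝ≥0∞) (μ : Measure (Rn n)) (f : Rn n → ℝ≥0∞)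
    (lam : ℝ≥0∞) : ℝ≥0∞ :=
  (∫⁻ x in {x | r x ≠ ∞}, (f x / lam) ^ (r x).toReal ∂μ)
    + essSup (fun x => f x / lam) (μ.restrict {x | r x = ∞})

/-- The variable Lebesgue (quasi)norm `‖f‖_{r(·)}` with respect to a measure `μ`. -/
def eNorm {n : ℕ} (r : Rn n → ℝ≥0∞) (μ : Measure (Rn n)) (f : Rn n → ℝ≥0∞) : ℝ≥0∞ :=
  sInf {lam : ℝ≥0∞ | lam ≠ 0 ∧ eModular r μ f lam ≤ 1}

/-- The variable Lebesgue norm of a real-valued function with respect to Lebesgue measure. -/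
def vNorm {n : ℕ} (r : Rn n → ℝ≥0∞) (f : Rn n → ℝ) : ℝ≥0∞ :=
  eNorm r volume fun x => ENNReal.ofReal |f x|

/-- View a real-valued exponent as an extended-real-valued one. -/
def ofExp {n : ℕ} (p : Rn n → ℝ) : Rn n → ℝ≥0∞ := fun x => ENNReal.ofReal (p x)

/-- The conjugate of an extended real exponent: `1/t + 1/t' = 1`. -/
def econj (t : ℝ≥0∞) : ℝ≥0∞ :=
  if t = 1 then ∞ else if t = ∞ then 1 else ENNReal.ofReal (t.toReal / (t.toReal - 1))

/-- The pointwise conjugate exponent `p'(·)` of a real-valued exponent. -/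
def conjExp {n : ℕ} (p : Rn n → ℝ) : Rn n → ℝ≥0∞ := fun x => econj (ENNReal.ofReal (p x))

/-- A weight: a measurable function that is positive (and finite) a.e. -/
def IsWeight {n : ℕ} (w : Rn n → ℝ) : Prop :=
  Measurable w ∧ ∀ᵐ x ∂(volume : Measure (Rn n)), 0 < w x

/-- Local log-Hölder continuity `LH₀`. -/
def LH0 {n : ℕ} (p : Rn n → ℝ) : Prop :=
  ∃ C₀ > 0, ∀ x y : Rn n, dist x y < 1 / 2 →
    |1 / p x - 1 / p y| ≤ C₀ / (-Real.log (dist x y))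

/-- Log-Hölder continuity at infinity with a given asymptotic value `pinf`. -/
def LHinfWith {n : ℕ} (p : Rn n → ℝ) (pinf : ℝ) : Prop :=
  ∃ C > 0, ∀ x : Rn n, |1 / p x - 1 / pinf| ≤ C / Real.log (Real.exp 1 + ‖x‖)

/-- Log-Hölder continuity at infinity `LH∞`. -/
def LHinf {n : ℕ} (p : Rn n → ℝ) : Prop := ∃ pinf > 0, LHinfWith p pinf

/-- Log-Hölder continuity `LH = LH₀ ∩ LH∞`. -/
def LH {n : ℕ} (p : Rn n → ℝ) : Prop := LH0 p ∧ LHinf p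

/-- The bilinear variable Muckenhoupt condition `(w₁,w₂,w) ∈ A_{p⃗(·)}`. -/
def ApVec {n : ℕ} (p₁ p₂ p w₁ w₂ w : Rn n → ℝ) : Prop :=
  ∃ C : ℝ≥0∞, C ≠ ∞ ∧ ∀ Q : Cube n,
    Q.vol⁻¹ ^ 2 * vNorm (ofExp p) (Q.toSet.indicator w) *
      vNorm (conjExp p₁) (Q.toSet.indicator fun x => (w₁ x)⁻¹) *
      vNorm (conjExp p₂) (Q.toSet.indicator fun x => (w₂ x)⁻¹) ≤ C

/-- The variable Muckenhoupt class `A_{r(·)}` for an extended-real-valued exponent. -/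
def ApVarE {n : ℕ} (r : Rn n → ℝ≥0∞) (v : Rn n → ℝ) : Prop :=
  ∃ C : ℝ≥0∞, C ≠ ∞ ∧ ∀ Q : Cube n,
    Q.vol⁻¹ * vNorm r (Q.toSet.indicator v) *
      vNorm (fun x => econj (r x)) (Q.toSet.indicator fun x => (v x)⁻¹) ≤ C

/-- The bilinear maximal operator `M(f₁,f₂)`. -/
def biMax {n : ℕ} (f₁ f₂ : Rn n → ℝ) (x : Rn n) : ℝ≥0∞ :=
  ⨆ (Q : Cube n) (_ : x ∈ Q.toSet),
    (Q.vol⁻¹ * ∫⁻ y in Q.toSet, ENNReal.ofReal |f₁ y|) *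
      (Q.vol⁻¹ * ∫⁻ y in Q.toSet, ENNReal.ofReal |f₂ y|)

/-- The dyadic bilinear maximal operator `M^d(f₁,f₂)`. -/
def biMaxD {n : ℕ} (f₁ f₂ : Rn n → ℝ) (x : Rn n) : ℝ≥0∞ :=
  ⨆ (Q : Cube n) (_ : Q.IsDyadic) (_ : x ∈ Q.toSet),
    (Q.vol⁻¹ * ∫⁻ y in Q.toSet, ENNReal.ofReal |f₁ y|) *
      (Q.vol⁻¹ * ∫⁻ y in Q.toSet, ENNReal.ofReal |f₂ y|)

/-- The bilinear averaging operator `A_Q(f₁,f₂) = (⨍_Q f₁)(⨍_Q f₂)χ_Q`. -/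
def avgOp {n : ℕ} (Q : Cube n) (f₁ f₂ : Rn n → ℝ) (x : Rn n) : ℝ≥0∞ :=
  Q.toSet.indicator
    (fun _ =>
      (Q.vol⁻¹ * ∫⁻ y in Q.toSet, ENNReal.ofReal |f₁ y|) *
        (Q.vol⁻¹ * ∫⁻ y in Q.toSet, ENNReal.ofReal |f₂ y|)) x

/-- `(p)₋(Q)`, the essential infimum of `p` on a cube `Q`. -/
def pMinusOn {n : ℕ} (p : Rn n → ℝ) (Q : Cube n) : ℝ :=
  essInf p (volume.restrict Q.toSet)

/-- The exponent `q(Q)` with `1/q(Q) = 1/(p₁)₋(Q) + 1/(p₂)₋(Q)`. -/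
def qExp {n : ℕ} (p₁ p₂ : Rn n → ℝ) (Q : Cube n) : ℝ :=
  ((pMinusOn p₁ Q)⁻¹ + (pMinusOn p₂ Q)⁻¹)⁻¹

/-- The classical Muckenhoupt class `A_r` for a constant exponent `1 < r < ∞`. -/
def MuckAp {n : ℕ} (r : ℝ) (v : Rn n → ℝ) : Prop :=
  ∃ C : ℝ≥0∞, C ≠ ∞ ∧ ∀ Q : Cube n,
    (Q.vol⁻¹ * ∫⁻ x in Q.toSet, ENNReal.ofReal (v x)) *
      (Q.vol⁻¹ * ∫⁻ x in Q.toSet, ENNReal.ofReal (v x ^ (1 - r / (r - 1)))) ^ (r - 1) ≤ C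

/-- The Muckenhoupt class `A_∞ = ⋃_{r>1} A_r`. -/
def MuckAinf {n : ℕ} (v : Rn n → ℝ) : Prop := ∃ r : ℝ, 1 < r ∧ MuckAp r v

namespace Cube

lemma toSet_eq_pi {n : ℕ} (Q : Cube n) :
    Q.toSet = Set.pi univ fun i => Ico (Q.base i) (Q.base i + Q.side) := by
  ext x
  simp [toSet, Set.mem_pi]

lemma measurableSet_toSet {n : ℕ} (Q : Cube n) : MeasurableSet Q.toSet := by
  rw [toSet_eq_pi]
  exact MeasurableSet.univ_pi fun i => measurableSet_Ico

lemma volume_toSet {n : ℕ} (Q : Cube n) : volume Q.toSet = ENNReal.ofReal (Q.side ^ n) := by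
  rw [toSet_eq_pi, Real.volume_pi_Ico]
  simp [ENNReal.ofReal_pow Q.side_pos.le]

lemma measure_pos {n : ℕ} (Q : Cube n) : 0 < Q.side ^ n := pow_pos Q.side_pos n

lemma norm_sub_base_le {n : ℕ} (Q : Cube n) {x : Rn n} (hx : x ∈ Q.toSet) :
    ‖x - Q.base‖ ≤ Q.side := by
  rw [pi_norm_le_iff_of_nonneg Q.side_pos.le]
  intro i
  have := hx i
  rw [Pi.sub_apply, Real.norm_eq_abs, abs_le]
  constructor <;> linarith

lemma norm_le {n : ℕ} (Q : Cube n) {x : Rn n} (hx : x ∈ Q.toSet) :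
    ‖x‖ ≤ ‖Q.base‖ + Q.side := by
  have h := Q.norm_sub_base_le hx
  have h2 := norm_sub_norm_le x Q.base
  linarith

lemma le_norm {n : ℕ} (Q : Cube n) {x : Rn n} (hx : x ∈ Q.toSet) :
    ‖Q.base‖ - Q.side ≤ ‖x‖ := by
  have h := Q.norm_sub_base_le hx
  have h2 := norm_sub_norm_le Q.base x
  rw [norm_sub_rev] at h2
  linarith

lemma dist_le {n : ℕ} (Q : Cube n) {x y : Rn n} (hx : x ∈ Q.toSet) (hy : y ∈ Q.toSet) :
    dist x y ≤ Q.side := by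
  rw [dist_pi_le_iff Q.side_pos.le]
  intro i
  have := hx i
  have := hy i
  rw [Real.dist_eq, abs_le]
  constructor <;> linarith

/-- The cube `[-R, R)ⁿ`. -/
def centered (n : ℕ) (R : ℝ) (hR : 0 < R) : Cube n := ⟨fun _ => -R, 2 * R, by linarith⟩

lemma mem_centered {n : ℕ} {R : ℝ} (hR : 0 < R) {x : Rn n} (hx : ‖x‖ < R) :
    x ∈ (centered n R hR).toSet := by
  intro i
  have h : |x i| < R := (norm_le_pi_norm x i).trans_lt hx
  rw [abs_lt] at h
  simp only [centered]
  constructor <;> linarith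

lemma norm_base_centered_le {n : ℕ} {R : ℝ} (hR : 0 < R) : ‖(centered n R hR).base‖ ≤ R := by
  rw [pi_norm_le_iff_of_nonneg hR.le]
  intro i
  simp [centered, abs_of_pos hR]

/-- The radius of a centered cube containing both `Q` and the cube `[-1, 1)ⁿ`. -/
def hull {n : ℕ} (Q : Cube n) : ℝ := ‖Q.base‖ + Q.side + 1

lemma one_le_hull {n : ℕ} (Q : Cube n) : 1 ≤ Q.hull := by
  have := Q.side_pos
  have := norm_nonneg Q.base
  unfold hull; linarith

lemma hull_pos {n : ℕ} (Q : Cube n) : 0 < Q.hull := one_pos.trans_le Q.one_le_hull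

lemma subset_centered_hull {n : ℕ} (Q : Cube n) :
    Q.toSet ⊆ (centered n Q.hull Q.hull_pos).toSet := by
  intro x hx
  apply mem_centered
  have := Q.norm_le hx
  unfold hull; linarith

lemma centered_subset_centered {n : ℕ} {R S : ℝ} (hR : 0 < R) (hS : 0 < S) (h : R ≤ S) :
    (centered n R hR).toSet ⊆ (centered n S hS).toSet := by
  intro x hx i
  have := hx i
  simp only [centered] at this ⊢
  constructor <;> linarith

end Cube

/-- Data on a cube `Q` witnessing a Muckenhoupt type bound for the weight `f` with variable
exponent `e`: `lam` dominates the norm of `f` on `Q`, and `M`, `g` control `1 / f`. -/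
structure CubeBound {n : ℕ} (f e : Rn n → ℝ) (A : ℝ) (Q : Cube n) (lam M : ℝ) (g : Rn n → ℝ) :
    Prop where
  lam_pos : 0 < lam
  M_pos : 0 < M
  g_nonneg : ∀ᵐ x, 0 ≤ g x
  g_meas : Measurable g
  int_f : ∫⁻ x in Q.toSet, ENNReal.ofReal ((f x / lam) ^ e x) ≤ 1
  int_g : ∫⁻ x in Q.toSet, ENNReal.ofReal (g x) ≤ 2
  one_le : ∀ᵐ x, 1 ≤ f x * M * g x ^ (2 - 1 / e x)
  mul_le : lam * M ≤ A * (Q.side ^ n) ^ 2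

lemma inv_sqrt_le_add {f e l M g : ℝ} (hf : 0 < f) (he : 1 / 2 < e) (hl : 0 < l) (hM : 0 < M)
    (hg : 0 ≤ g) (h : 1 ≤ f * M * g ^ (2 - 1 / e)) :
    (Real.sqrt (l * M))⁻¹ ≤ (f / l) ^ e + g := by
  have he0 : 0 < e := by linarith
  have he2 : 0 ≤ 2 - 1 / e := by
    rw [sub_nonneg, div_le_iff₀ he0]; linarith
  set F := (f / l) ^ e with hF
  have hF0 : 0 < F := Real.rpow_pos_of_pos (by positivity) _
  have hfF : f = l * F ^ (1 / e) := by
    rw [hF, ← Real.rpow_mul (by positivity), mul_one_div_cancel he0.ne', Real.rpow_one]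
    field_simp
  have h1 : F ^ (1 / e) * g ^ (2 - 1 / e) ≤ (F + g) ^ 2 := by
    calc F ^ (1 / e) * g ^ (2 - 1 / e) ≤ (F + g) ^ (1 / e) * (F + g) ^ (2 - 1 / e) := by
          gcongr <;> linarith
      _ = (F + g) ^ 2 := by
          rw [← Real.rpow_add (by positivity)]
          norm_num
  have h2 : 1 ≤ (l * M) * (F + g) ^ 2 := by
    calc 1 ≤ f * M * g ^ (2 - 1 / e) := h
      _ = (l * M) * (F ^ (1 / e) * g ^ (2 - 1 / e)) := by rw [hfF]; ring
      _ ≤ _ := by gcongr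
  rw [inv_le_iff_one_le_mul₀ (by positivity)]
  have h3 : 1 ≤ ((F + g) * Real.sqrt (l * M)) ^ 2 := by
    rw [mul_pow, Real.sq_sqrt (by positivity)]; linarith
  exact (one_le_sq_iff₀ (by positivity)).1 h3

/-- Young's inequality on a cube `E` contained in the cubes `Q` and `R`. -/
lemma sq_measure_le {n : ℕ} {f e : Rn n → ℝ} {A : ℝ} {Q R E : Cube n} {l M l' M' : ℝ}
    {g g' : Rn n → ℝ}
    (hf : ∀ᵐ x, 0 < f x) (he : ∀ᵐ x, 1 / 2 < e x) (hfm : Measurable f) (hem : Measurable e)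
    (hQ : CubeBound f e A Q l M g) (hR : CubeBound f e A R l' M' g')
    (hEQ : E.toSet ⊆ Q.toSet) (hER : E.toSet ⊆ R.toSet) :
    (E.side ^ n) ^ 2 ≤ 9 * (l * M') := by
  have hl := hQ.lam_pos
  have hlM : 0 < l * M' := mul_pos hl hR.M_pos
  have key : ENNReal.ofReal ((Real.sqrt (l * M'))⁻¹) * ENNReal.ofReal (E.side ^ n) ≤ 1 + 2 := by
    rw [← E.volume_toSet, ← setLIntegral_const]
    calc ∫⁻ _ in E.toSet, ENNReal.ofReal ((Real.sqrt (l * M'))⁻¹)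
        ≤ ∫⁻ x in E.toSet, (ENNReal.ofReal ((f x / l) ^ e x) + ENNReal.ofReal (g' x)) := by
          apply lintegral_mono_ae
          apply ae_restrict_of_ae
          filter_upwards [hf, he, hR.one_le, hR.g_nonneg] with x h1 h2 h3 h4
          rw [← ENNReal.ofReal_add (by positivity) h4]
          exact ENNReal.ofReal_le_ofReal
            (inv_sqrt_le_add h1 h2 hQ.lam_pos hR.M_pos h4 h3)
      _ = (∫⁻ x in E.toSet, ENNReal.ofReal ((f x / l) ^ e x)) +
            ∫⁻ x in E.toSet, ENNReal.ofReal (g' x) := by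
          rw [lintegral_add_left (by fun_prop)]
      _ ≤ 1 + 2 := add_le_add ((lintegral_mono_set hEQ).trans hQ.int_f)
            ((lintegral_mono_set hER).trans hR.int_g)
  rw [← ENNReal.ofReal_mul (by positivity), show (1 + 2 : ℝ≥0∞) = ENNReal.ofReal 3 by norm_num,
    ENNReal.ofReal_le_ofReal_iff (by norm_num), inv_mul_le_iff₀ (by positivity)] at key
  have := pow_le_pow_left₀ E.measure_pos.le key 2
  rw [mul_pow, Real.sq_sqrt hlM.le] at this
  linarith

/-- The norms of `f` on cubes are polynomially bounded above and below. -/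
lemma exists_polynomial_bounds {n : ℕ} {f e : Rn n → ℝ} {A : ℝ} {l M : Cube n → ℝ}
    {g : Cube n → Rn n → ℝ}
    (hf : ∀ᵐ x, 0 < f x) (he : ∀ᵐ x, 1 / 2 < e x) (hfm : Measurable f) (hem : Measurable e)
    (hA : 0 < A) (hQ : ∀ Q, CubeBound f e A Q (l Q) (M Q) (g Q)) :
    ∃ c C : ℝ, 0 < c ∧ 1 ≤ C ∧ ∀ Q : Cube n,
      c * (Q.side / Q.hull) ^ (2 * n) ≤ l Q ∧ l Q ≤ C * Q.hull ^ (2 * n) := by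
  set Q₀ := Cube.centered n 1 one_pos with hQ₀
  have hs₀ : 0 < (Q₀.side ^ n) ^ 2 := pow_pos Q₀.measure_pos 2
  have hM₀ := (hQ Q₀).M_pos
  have hl₀ := (hQ Q₀).lam_pos
  refine ⟨(Q₀.side ^ n) ^ 2 / (9 * M Q₀) / (9 * A * 2 ^ (2 * n)),
    max 1 (81 * A ^ 2 * 2 ^ (2 * n) * l Q₀ / (Q₀.side ^ n) ^ 2), by positivity,
    le_max_left _ _, fun Q => ?_⟩
  have hT := Q.hull_pos
  set T := Q.hull with hTdef
  set P := Cube.centered n T hT with hP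
  have hsub : Q.toSet ⊆ P.toSet := Q.subset_centered_hull
  have hsub₀ : Q₀.toSet ⊆ P.toSet :=
    Cube.centered_subset_centered one_pos hT Q.one_le_hull
  have b1 := sq_measure_le hf he hfm hem (hQ Q) (hQ P) subset_rfl hsub
  have b2 := sq_measure_le hf he hfm hem (hQ P) (hQ Q) hsub subset_rfl
  have b3 := sq_measure_le hf he hfm hem (hQ P) (hQ Q₀) hsub₀ subset_rfl
  have b4 := sq_measure_le hf he hfm hem (hQ Q₀) (hQ P) subset_rfl hsub₀
  have mP := (hQ P).mul_le
  have mQ := (hQ Q).mul_le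
  have lP := (hQ P).lam_pos
  have lQ := (hQ Q).lam_pos
  have MP := (hQ P).M_pos
  have MQ := (hQ Q).M_pos
  have hPs : (P.side ^ n) ^ 2 = 2 ^ (2 * n) * T ^ (2 * n) := by
    simp only [hP, Cube.centered]; rw [mul_pow, mul_pow, ← pow_mul, ← pow_mul]; ring_nf
  have hQs : (Q.side ^ n) ^ 2 = Q.side ^ (2 * n) := by rw [← pow_mul, mul_comm]
  have hQsp := Q.measure_pos
  constructor
  · rw [div_pow, ← hQs, ← mul_div_assoc, div_le_iff₀ (by positivity), div_mul_eq_mul_div,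
      div_le_iff₀ (by positivity), div_mul_eq_mul_div, div_le_iff₀ (by positivity)]
    rw [hPs] at mP
    calc (Q₀.side ^ n) ^ 2 * (Q.side ^ n) ^ 2
        ≤ (9 * (l P * M Q₀)) * (9 * (l Q * M P)) := by gcongr
      _ = 81 * M Q₀ * l Q * (l P * M P) := by ring
      _ ≤ 81 * M Q₀ * l Q * (A * (2 ^ (2 * n) * T ^ (2 * n))) := by gcongr
      _ = _ := by ring
  · have h1 : l Q ≤ 9 * A * l P := by
      have : l Q * M Q ≤ (9 * A * l P) * M Q := by
        calc l Q * M Q ≤ A * (Q.side ^ n) ^ 2 := mQ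
          _ ≤ A * (9 * (l P * M Q)) := by gcongr
          _ = _ := by ring
      exact le_of_mul_le_mul_right this MQ
    have h2 : l P ≤ 9 * A * 2 ^ (2 * n) * l Q₀ / (Q₀.side ^ n) ^ 2 * T ^ (2 * n) := by
      rw [div_mul_eq_mul_div, le_div_iff₀ hs₀]
      have : (l P * (Q₀.side ^ n) ^ 2) ≤
          (9 * l Q₀ * (A * (2 ^ (2 * n) * T ^ (2 * n)))) := by
        calc l P * (Q₀.side ^ n) ^ 2 ≤ l P * (9 * (l Q₀ * M P)) := by gcongr
          _ = 9 * l Q₀ * (l P * M P) := by ring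
          _ ≤ _ := by rw [← hPs]; gcongr
      linarith
    calc l Q ≤ 9 * A * l P := h1
      _ ≤ 9 * A * (9 * A * 2 ^ (2 * n) * l Q₀ / (Q₀.side ^ n) ^ 2 * T ^ (2 * n)) := by gcongr
      _ = 81 * A ^ 2 * 2 ^ (2 * n) * l Q₀ / (Q₀.side ^ n) ^ 2 * T ^ (2 * n) := by ring
      _ ≤ _ := by gcongr; exact le_max_right _ _

lemma inv_rpow_le {f e b l M A S g t q : ℝ} (hf : 0 < f) (he : 1 / 2 < e) (heb : e ≤ b)
    (hl : 0 < l) (hA : 1 ≤ A) (hS : 0 < S) (hg : 0 ≤ g)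
    (h : 1 ≤ f * M * g ^ (2 - 1 / e)) (hlM : l * M ≤ A * S ^ 2) (ht : 4 * b ≤ t) :
    (f ^ e) ^ (-(1 / t)) ≤
      (l ^ (-q) * S * A ^ b) ^ (1 / t) * (1 + S * g + l ^ (2 / t * (q - e))) := by
  have he0 : 0 < e := by linarith
  have ht0 : 0 < t := by linarith
  have he2 : 0 < 2 - 1 / e := by
    rw [sub_pos, div_lt_iff₀ he0]; linarith
  have hg0 : 0 < g := by
    rcases hg.eq_or_lt with h0 | h0
    · rw [← h0, Real.zero_rpow he2.ne'] at h; norm_num at h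
    · exact h0
  have hMl : M ≤ A * S ^ 2 / l := by rw [le_div_iff₀ hl]; linarith
  have h1 : f⁻¹ ≤ A * S ^ 2 / l * g ^ (2 - 1 / e) := by
    rw [inv_le_iff_one_le_mul₀ hf]
    calc 1 ≤ f * M * g ^ (2 - 1 / e) := h
      _ ≤ f * (A * S ^ 2 / l) * g ^ (2 - 1 / e) := by gcongr
      _ = _ := by ring
  have hSg : 0 < S * g := by positivity
  have h2 : (f ^ e)⁻¹ ≤ A ^ b * (l ^ (-e) * S) * (S * g) ^ (2 * e - 1) := by
    rw [← Real.inv_rpow hf.le]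
    calc f⁻¹ ^ e ≤ (A * S ^ 2 / l * g ^ (2 - 1 / e)) ^ e := by gcongr
      _ = A ^ e * (l ^ (-e) * S) * (S * g) ^ (2 * e - 1) := by
        rw [Real.mul_rpow (by positivity) (by positivity),
          Real.div_rpow (by positivity) hl.le, Real.mul_rpow (by positivity) (by positivity),
          ← Real.rpow_mul hg, Real.rpow_neg hl.le, Real.mul_rpow hS.le hg,
          show (2 - 1 / e) * e = 2 * e - 1 by field_simp, ← Real.rpow_natCast S 2,
          ← Real.rpow_mul hS.le]
        have : S ^ (((2 : ℕ) : ℝ) * e) = S * S ^ (2 * e - 1) := by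
          rw [← Real.rpow_one_add' hS.le (by linarith)]
          congr 1; ring
        rw [this]
        ring
      _ ≤ _ := by gcongr
  have hθ : (2 * e - 1) / t ≤ 1 / 2 := by
    rw [div_le_iff₀ ht0]; linarith
  have h3 : (S * g) ^ ((2 * e - 1) / t) ≤ (1 + S * g) ^ (1 / 2 : ℝ) := by
    calc (S * g) ^ ((2 * e - 1) / t) ≤ (1 + S * g) ^ ((2 * e - 1) / t) := by
          apply Real.rpow_le_rpow hSg.le (by linarith)
          apply div_nonneg <;> linarith
      _ ≤ _ := Real.rpow_le_rpow_of_exponent_le (by linarith) hθ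
  have h4 : l ^ (-(e / t)) = (l ^ (-q)) ^ (1 / t) * (l ^ (2 / t * (q - e))) ^ (1 / 2 : ℝ) := by
    rw [← Real.rpow_mul hl.le, ← Real.rpow_mul hl.le, ← Real.rpow_add hl]
    congr 1; field_simp; ring
  set X := l ^ (2 / t * (q - e)) with hX
  have hX0 : 0 < X := Real.rpow_pos_of_pos hl _
  have h5 : X ^ (1 / 2 : ℝ) * (1 + S * g) ^ (1 / 2 : ℝ) ≤ 1 + S * g + X := by
    calc X ^ (1 / 2 : ℝ) * (1 + S * g) ^ (1 / 2 : ℝ)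
        ≤ (1 + S * g + X) ^ (1 / 2 : ℝ) * (1 + S * g + X) ^ (1 / 2 : ℝ) := by
          have hXle : X ≤ 1 + S * g + X := by linarith
          have hgle : 1 + S * g ≤ 1 + S * g + X := by linarith
          gcongr
      _ = _ := by
          rw [← Real.rpow_add (by positivity)]; norm_num
  calc (f ^ e) ^ (-(1 / t)) = ((f ^ e)⁻¹) ^ (1 / t) := by
        rw [Real.rpow_neg (by positivity), Real.inv_rpow (by positivity)]
    _ ≤ (A ^ b * (l ^ (-e) * S) * (S * g) ^ (2 * e - 1)) ^ (1 / t) := by gcongr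
    _ = (A ^ b) ^ (1 / t) * (l ^ (-(e / t)) * S ^ (1 / t)) * (S * g) ^ ((2 * e - 1) / t) := by
        rw [Real.mul_rpow (by positivity) (by positivity),
          Real.mul_rpow (by positivity) (by positivity),
          Real.mul_rpow (by positivity) (by positivity), ← Real.rpow_mul hSg.le,
          ← Real.rpow_mul hl.le]
        congr 3
        · congr 1; ring
        · ring
    _ = (l ^ (-q) * S * A ^ b) ^ (1 / t) *
          (X ^ (1 / 2 : ℝ) * (S * g) ^ ((2 * e - 1) / t)) := by
        rw [h4, Real.mul_rpow (x := l ^ (-q) * S) (by positivity) (by positivity),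
          Real.mul_rpow (x := l ^ (-q)) (by positivity) (by positivity)]
        ring
    _ ≤ (l ^ (-q) * S * A ^ b) ^ (1 / t) * (X ^ (1 / 2 : ℝ) * (1 + S * g) ^ (1 / 2 : ℝ)) := by
        gcongr
    _ ≤ _ := by gcongr

lemma muckenhoupt_product_le {n : ℕ} {f e : Rn n → ℝ} {A b t q K : ℝ} {Q : Cube n} {l M : ℝ}
    {g : Rn n → ℝ}
    (hf : ∀ᵐ x, 0 < f x) (he : ∀ᵐ x, 1 / 2 < e x ∧ e x ≤ b) (hem : Measurable e)
    (hA : 1 ≤ A) (ht : 4 * b ≤ t) (hb : 0 < b) (hK : 0 ≤ K) (hQ : CubeBound f e A Q l M g)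
    (hW : ∫⁻ x in Q.toSet, ENNReal.ofReal (f x ^ e x) ≤ ENNReal.ofReal (K * l ^ q))
    (hl : ∫⁻ x in Q.toSet, ENNReal.ofReal (l ^ (2 / t * (q - e x))) ≤
      ENNReal.ofReal (K * Q.side ^ n)) :
    (Q.vol⁻¹ * ∫⁻ x in Q.toSet, ENNReal.ofReal (f x ^ e x)) *
      (Q.vol⁻¹ * ∫⁻ x in Q.toSet, ENNReal.ofReal ((f x ^ e x) ^ (-(1 / t)))) ^ t ≤
      ENNReal.ofReal (K * A ^ b * (3 + K) ^ t) := by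
  have hl0 := hQ.lam_pos
  have ht0 : 0 < t := by linarith
  set S := Q.side ^ n with hSdef
  have hS : 0 < S := Q.measure_pos
  set c := (l ^ (-q) * S * A ^ b) ^ (1 / t) with hc
  have hc0 : 0 < c := by positivity
  have h1 : ∫⁻ x in Q.toSet, ENNReal.ofReal ((f x ^ e x) ^ (-(1 / t))) ≤
      ENNReal.ofReal (c * ((3 + K) * S)) := by
    calc ∫⁻ x in Q.toSet, ENNReal.ofReal ((f x ^ e x) ^ (-(1 / t)))
        ≤ ∫⁻ x in Q.toSet, ENNReal.ofReal c *
            (1 + ENNReal.ofReal S * ENNReal.ofReal (g x) +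
              ENNReal.ofReal (l ^ (2 / t * (q - e x)))) := by
          apply lintegral_mono_ae
          apply ae_restrict_of_ae
          filter_upwards [hf, he, hQ.one_le, hQ.g_nonneg] with x h1 h2 h3 h4
          have := inv_rpow_le (q := q) h1 h2.1 h2.2 hl0 hA hS h4 h3 hQ.mul_le ht
          refine (ENNReal.ofReal_le_ofReal this).trans (le_of_eq ?_)
          rw [ENNReal.ofReal_mul hc0.le, ENNReal.ofReal_add (by positivity) (by positivity),
            ENNReal.ofReal_add (by positivity) (by positivity), ENNReal.ofReal_mul hS.le,
            ENNReal.ofReal_one]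
      _ = ENNReal.ofReal c * (ENNReal.ofReal S +
            ENNReal.ofReal S * (∫⁻ x in Q.toSet, ENNReal.ofReal (g x)) +
            ∫⁻ x in Q.toSet, ENNReal.ofReal (l ^ (2 / t * (q - e x)))) := by
          have hgm := hQ.g_meas
          rw [lintegral_const_mul _ (by fun_prop), lintegral_add_left (by fun_prop),
            lintegral_add_left (by fun_prop), lintegral_const_mul _ (by fun_prop),
            setLIntegral_const, Q.volume_toSet, one_mul]
      _ ≤ ENNReal.ofReal c * (ENNReal.ofReal S + ENNReal.ofReal S * 2 +
            ENNReal.ofReal (K * S)) := by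
          gcongr
          exact hQ.int_g
      _ = _ := by
          rw [show (2 : ℝ≥0∞) = ENNReal.ofReal 2 by norm_num, ← ENNReal.ofReal_mul hS.le,
            ← ENNReal.ofReal_add (by positivity) (by positivity),
            ← ENNReal.ofReal_add (by positivity) (by positivity), ← ENNReal.ofReal_mul hc0.le]
          congr 1; ring
  have hvol : Q.vol⁻¹ = ENNReal.ofReal S⁻¹ := by
    rw [Cube.vol, ENNReal.ofReal_inv_of_pos hS]
  rw [hvol]
  calc (ENNReal.ofReal S⁻¹ * ∫⁻ x in Q.toSet, ENNReal.ofReal (f x ^ e x)) *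
      (ENNReal.ofReal S⁻¹ * ∫⁻ x in Q.toSet, ENNReal.ofReal ((f x ^ e x) ^ (-(1 / t)))) ^ t
      ≤ (ENNReal.ofReal S⁻¹ * ENNReal.ofReal (K * l ^ q)) *
      (ENNReal.ofReal S⁻¹ * ENNReal.ofReal (c * ((3 + K) * S))) ^ t := by gcongr
    _ = ENNReal.ofReal (S⁻¹ * (K * l ^ q) * (S⁻¹ * (c * ((3 + K) * S))) ^ t) := by
      rw [← ENNReal.ofReal_mul (by positivity), ← ENNReal.ofReal_mul (by positivity),
        ENNReal.ofReal_rpow_of_nonneg (by positivity) ht0.le,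
        ← ENNReal.ofReal_mul (by positivity)]
    _ = _ := by
      congr 1
      have : S⁻¹ * (c * ((3 + K) * S)) = c * (3 + K) := by field_simp
      rw [this, Real.mul_rpow hc0.le (by positivity), hc, ← Real.rpow_mul (by positivity),
        one_div_mul_cancel ht0.ne', Real.rpow_one, Real.rpow_neg hl0.le]
      have : l ^ q ≠ 0 := (Real.rpow_pos_of_pos hl0 _).ne'
      field_simp

lemma rpow_le_exp_of_abs_log_mul_le {l y K : ℝ} (hl : 0 < l) (h : |Real.log l| * |y| ≤ K) :
    l ^ y ≤ Real.exp K := by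
  rw [Real.rpow_def_of_pos hl]
  apply Real.exp_le_exp.2
  rw [← abs_mul] at h
  exact (le_abs_self _).trans h

/-- The integral conditions of `muckenhoupt_product_le` when `l ^ e x` is comparable with a
constant on the cube. -/
lemma integral_bounds_of_pointwise {n : ℕ} {f e : Rn n → ℝ} {A t q K : ℝ} {Q : Cube n} {l M : ℝ}
    {g : Rn n → ℝ} (hf : ∀ᵐ x, 0 < f x) (ht : 2 ≤ t) (hQ : CubeBound f e A Q l M g)
    (h : ∀ᵐ x, x ∈ Q.toSet → |Real.log l| * |e x - q| ≤ K) :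
    ∫⁻ x in Q.toSet, ENNReal.ofReal (f x ^ e x) ≤ ENNReal.ofReal (Real.exp K * l ^ q) ∧
    ∫⁻ x in Q.toSet, ENNReal.ofReal (l ^ (2 / t * (q - e x))) ≤
      ENNReal.ofReal (Real.exp K * Q.side ^ n) := by
  have hl := hQ.lam_pos
  have h' := (ae_restrict_iff' Q.measurableSet_toSet).2 h
  constructor
  · calc ∫⁻ x in Q.toSet, ENNReal.ofReal (f x ^ e x)
        ≤ ∫⁻ x in Q.toSet, ENNReal.ofReal (Real.exp K * l ^ q) *
            ENNReal.ofReal ((f x / l) ^ e x) := by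
          apply lintegral_mono_ae
          filter_upwards [h', ae_restrict_of_ae hf] with x h1 h2
          rw [← ENNReal.ofReal_mul (by positivity)]
          apply ENNReal.ofReal_le_ofReal
          have h3 : f x ^ e x = l ^ (e x - q) * l ^ q * (f x / l) ^ e x := by
            rw [← Real.rpow_add hl, sub_add_cancel, ← Real.mul_rpow hl.le (by positivity)]
            congr 1; field_simp
          rw [h3]
          gcongr
          exact rpow_le_exp_of_abs_log_mul_le hl h1
      _ = ENNReal.ofReal (Real.exp K * l ^ q) *
            ∫⁻ x in Q.toSet, ENNReal.ofReal ((f x / l) ^ e x) := by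
          rw [lintegral_const_mul' _ _ ENNReal.ofReal_ne_top]
      _ ≤ ENNReal.ofReal (Real.exp K * l ^ q) * 1 := by gcongr; exact hQ.int_f
      _ = _ := mul_one _
  · calc ∫⁻ x in Q.toSet, ENNReal.ofReal (l ^ (2 / t * (q - e x)))
        ≤ ∫⁻ x in Q.toSet, ENNReal.ofReal (Real.exp K) := by
          apply lintegral_mono_ae
          filter_upwards [h'] with x h1
          apply ENNReal.ofReal_le_ofReal
          apply rpow_le_exp_of_abs_log_mul_le hl
          have h2t : 2 / t ≤ 1 := by rw [div_le_one (by linarith)]; exact ht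
          have h2t' : 0 ≤ 2 / t := by apply div_nonneg <;> linarith
          rw [abs_mul, abs_of_nonneg h2t', abs_sub_comm]
          calc |Real.log l| * (2 / t * |e x - q|) = 2 / t * (|Real.log l| * |e x - q|) := by ring
            _ ≤ 1 * (|Real.log l| * |e x - q|) := by gcongr
            _ ≤ K := by rw [one_mul]; exact h1
      _ = _ := by
          rw [setLIntegral_const, Q.volume_toSet, ENNReal.ofReal_mul (Real.exp_pos _).le]

lemma setLIntegral_rpow_le {n : ℕ} {f e : Rn n → ℝ} {A b L : ℝ} {Q : Cube n} {l M : ℝ}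
    {g : Rn n → ℝ} (hf : ∀ᵐ x, 0 < f x) (he : ∀ᵐ x, 1 / 2 < e x ∧ e x ≤ b)
    (hQ : CubeBound f e A Q l M g) (hlL : l ≤ L) (hL : 1 ≤ L) :
    ∫⁻ x in Q.toSet, ENNReal.ofReal (f x ^ e x) ≤ ENNReal.ofReal (L ^ b) := by
  have hl := hQ.lam_pos
  calc ∫⁻ x in Q.toSet, ENNReal.ofReal (f x ^ e x)
      ≤ ∫⁻ x in Q.toSet, ENNReal.ofReal (L ^ b) * ENNReal.ofReal ((f x / l) ^ e x) := by
        apply lintegral_mono_ae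
        filter_upwards [ae_restrict_of_ae hf, ae_restrict_of_ae he] with x h1 h2
        rw [← ENNReal.ofReal_mul (by positivity)]
        apply ENNReal.ofReal_le_ofReal
        have h3 : f x ^ e x = l ^ e x * (f x / l) ^ e x := by
          rw [← Real.mul_rpow hl.le (by positivity)]
          congr 1; field_simp
        rw [h3]
        have h4 : l ^ e x ≤ L ^ b :=
          (Real.rpow_le_rpow hl.le hlL (by linarith)).trans
            (Real.rpow_le_rpow_of_exponent_le hL h2.2)
        gcongr
    _ = ENNReal.ofReal (L ^ b) * ∫⁻ x in Q.toSet, ENNReal.ofReal ((f x / l) ^ e x) := by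
        rw [lintegral_const_mul' _ _ ENNReal.ofReal_ne_top]
    _ ≤ ENNReal.ofReal (L ^ b) * 1 := by gcongr; exact hQ.int_f
    _ = _ := mul_one _

lemma abs_log_mul_le_of_rpow_le_norm {n : ℕ} {x : Rn n} {l η d C : ℝ} (hl : 1 ≤ l) (hη : 0 < η)
    (hx : l ^ η ≤ ‖x‖) (hC : |d| * Real.log (Real.exp 1 + ‖x‖) ≤ C) :
    |Real.log l| * |d| ≤ C / η := by
  have hl0 : 0 < l := by linarith
  have h1 : η * Real.log l ≤ Real.log (Real.exp 1 + ‖x‖) := by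
    rw [← Real.log_rpow hl0]
    apply Real.log_le_log (by positivity)
    have := Real.exp_pos 1
    linarith
  rw [abs_of_nonneg (Real.log_nonneg hl), le_div_iff₀ hη]
  calc Real.log l * |d| * η = |d| * (η * Real.log l) := by ring
    _ ≤ |d| * Real.log (Real.exp 1 + ‖x‖) := by gcongr
    _ ≤ C := hC

/-- The integral conditions of `muckenhoupt_product_le` on large cubes close to the origin. -/
lemma integral_bounds_of_one_le {n : ℕ} {f e : Rn n → ℝ} {A b t q η C₀ C₁ C₂ : ℝ}
    {l M : Cube n → ℝ} {g : Cube n → Rn n → ℝ} {Q : Cube n}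
    (hf : ∀ᵐ x, 0 < f x) (he : ∀ᵐ x, 1 / 2 < e x ∧ e x ≤ b)
    (hfm : Measurable f) (hem : Measurable e)
    (ht : 2 ≤ t) (hη : 0 < η)
    (hηb : η * (2 * n * b) ≤ q) (hηt : n * η + 2 / t * q ≤ 1 / 2)
    (hQ : ∀ Q, CubeBound f e A Q (l Q) (M Q) (g Q))
    (hC₁ : 1 ≤ C₁) (hlC : ∀ Q, l Q ≤ C₁ * Q.hull ^ (2 * n))
    (hlog : ∀ᵐ x, |e x - q| * Real.log (Real.exp 1 + ‖x‖) ≤ C₀)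
    (hlQ : 1 ≤ l Q) (hC₂ : 0 ≤ C₂) (hlQ' : l Q ≤ C₂ * (Q.side ^ n) ^ 2) :
    ∫⁻ x in Q.toSet, ENNReal.ofReal (f x ^ e x) ≤
      ENNReal.ofReal ((Real.exp (C₀ / η) + (C₁ * 4 ^ (2 * n)) ^ b) * l Q ^ q) ∧
    ∫⁻ x in Q.toSet, ENNReal.ofReal (l Q ^ (2 / t * (q - e x))) ≤
      ENNReal.ofReal ((Real.exp (C₀ / η) + 2 ^ n * Real.sqrt C₂) * Q.side ^ n) := by
  set L := l Q with hL
  have hL0 : 0 < L := by linarith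
  set ρ := L ^ η with hρdef
  have hρ : 1 ≤ ρ := Real.one_le_rpow hlQ hη.le
  have hρ0 : 0 < ρ := by linarith
  set P := Cube.centered n ρ hρ0 with hP
  have hPm := P.measurableSet_toSet
  have h2t : 2 / t ≤ 1 := by rw [div_le_one (by linarith)]; exact ht
  have h2t' : 0 ≤ 2 / t := by apply div_nonneg <;> linarith
  have hS := Q.measure_pos
  have hPpos := P.measure_pos
  constructor
  · have hPb : ∫⁻ x in P.toSet, ENNReal.ofReal (f x ^ e x) ≤
        ENNReal.ofReal ((C₁ * 4 ^ (2 * n)) ^ b * L ^ q) := by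
      have hhull : P.hull ≤ 4 * ρ := by
        have : ‖P.base‖ ≤ ρ := Cube.norm_base_centered_le hρ0
        have h2 : P.side = 2 * ρ := rfl
        unfold Cube.hull; linarith
      have h1 : l P ≤ C₁ * (4 * ρ) ^ (2 * n) := by
        have := P.hull_pos
        refine (hlC P).trans ?_
        gcongr
      have h2 : 1 ≤ C₁ * (4 * ρ) ^ (2 * n) :=
        one_le_mul_of_one_le_of_one_le hC₁ (one_le_pow₀ (by linarith))
      refine (setLIntegral_rpow_le hf he (hQ P) h1 h2).trans ?_
      apply ENNReal.ofReal_le_ofReal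
      rw [mul_pow, ← mul_assoc, Real.mul_rpow (by positivity) (by positivity)]
      gcongr
      rw [hρdef, ← Real.rpow_natCast, ← Real.rpow_mul hL0.le, ← Real.rpow_mul hL0.le]
      apply Real.rpow_le_rpow_of_exponent_le hlQ
      push_cast
      linarith
    have hpt : ∀ᵐ x ∂(volume.restrict Q.toSet), ENNReal.ofReal (f x ^ e x) ≤
        ENNReal.ofReal (Real.exp (C₀ / η) * L ^ q) * ENNReal.ofReal ((f x / L) ^ e x) +
          P.toSet.indicator (fun x => ENNReal.ofReal (f x ^ e x)) x := by
      filter_upwards [ae_restrict_of_ae hf, ae_restrict_of_ae hlog] with x h1 h2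
      by_cases hx : ‖x‖ < ρ
      · rw [indicator_of_mem (Cube.mem_centered hρ0 hx)]
        exact le_add_self
      · refine le_trans ?_ le_self_add
        rw [← ENNReal.ofReal_mul (by positivity)]
        apply ENNReal.ofReal_le_ofReal
        have h3 : f x ^ e x = L ^ (e x - q) * L ^ q * (f x / L) ^ e x := by
          rw [← Real.rpow_add hL0, sub_add_cancel, ← Real.mul_rpow hL0.le (by positivity)]
          congr 1; field_simp
        rw [h3]
        gcongr
        exact rpow_le_exp_of_abs_log_mul_le hL0
          (abs_log_mul_le_of_rpow_le_norm hlQ hη (not_lt.1 hx) h2)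
    calc ∫⁻ x in Q.toSet, ENNReal.ofReal (f x ^ e x)
        ≤ ∫⁻ x in Q.toSet, (ENNReal.ofReal (Real.exp (C₀ / η) * L ^ q) *
            ENNReal.ofReal ((f x / L) ^ e x) +
          P.toSet.indicator (fun x => ENNReal.ofReal (f x ^ e x)) x) := lintegral_mono_ae hpt
      _ ≤ ENNReal.ofReal (Real.exp (C₀ / η) * L ^ q) +
            ENNReal.ofReal ((C₁ * 4 ^ (2 * n)) ^ b * L ^ q) := by
          rw [lintegral_add_left (by fun_prop), lintegral_indicator hPm,
            lintegral_const_mul' _ _ ENNReal.ofReal_ne_top]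
          refine add_le_add (mul_le_of_le_one_right' (hQ Q).int_f) (le_trans ?_ hPb)
          exact lintegral_mono' (Measure.restrict_mono le_rfl Measure.restrict_le_self) le_rfl
      _ = _ := by
          rw [← ENNReal.ofReal_add (by positivity) (by positivity), ← add_mul]
  · have hpt : ∀ᵐ x ∂(volume.restrict Q.toSet), ENNReal.ofReal (L ^ (2 / t * (q - e x))) ≤
        ENNReal.ofReal (Real.exp (C₀ / η)) +
          P.toSet.indicator (fun _ => ENNReal.ofReal (L ^ (2 / t * q))) x := by
      filter_upwards [ae_restrict_of_ae he, ae_restrict_of_ae hlog] with x h1 h2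
      by_cases hx : ‖x‖ < ρ
      · rw [indicator_of_mem (Cube.mem_centered hρ0 hx)]
        refine le_trans ?_ le_add_self
        apply ENNReal.ofReal_le_ofReal
        apply Real.rpow_le_rpow_of_exponent_le hlQ
        gcongr
        linarith
      · refine le_trans ?_ le_self_add
        apply ENNReal.ofReal_le_ofReal
        apply rpow_le_exp_of_abs_log_mul_le hL0
        have h3 := abs_log_mul_le_of_rpow_le_norm hlQ hη (not_lt.1 hx) h2
        rw [abs_mul, abs_of_nonneg h2t', abs_sub_comm]
        calc |Real.log L| * (2 / t * |e x - q|) = 2 / t * (|Real.log L| * |e x - q|) := by ring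
          _ ≤ 1 * (|Real.log L| * |e x - q|) := by gcongr
          _ ≤ _ := by rw [one_mul]; exact h3
    calc ∫⁻ x in Q.toSet, ENNReal.ofReal (L ^ (2 / t * (q - e x)))
        ≤ ∫⁻ x in Q.toSet, (ENNReal.ofReal (Real.exp (C₀ / η)) +
          P.toSet.indicator (fun _ => ENNReal.ofReal (L ^ (2 / t * q))) x) :=
          lintegral_mono_ae hpt
      _ ≤ ENNReal.ofReal (Real.exp (C₀ / η)) * ENNReal.ofReal (Q.side ^ n) +
            ENNReal.ofReal (L ^ (2 / t * q)) * ENNReal.ofReal (P.side ^ n) := by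
          rw [lintegral_add_left (by fun_prop), setLIntegral_const, Q.volume_toSet,
            lintegral_indicator hPm, setLIntegral_const, ← P.volume_toSet]
          gcongr
          exact Measure.restrict_le_self
      _ ≤ _ := by
          rw [← ENNReal.ofReal_mul (by positivity), ← ENNReal.ofReal_mul (by positivity),
            ← ENNReal.ofReal_add (by positivity) (by positivity), add_mul]
          apply ENNReal.ofReal_le_ofReal
          refine add_le_add le_rfl ?_
          have hPs : P.side ^ n = 2 ^ n * L ^ (n * η) := by
            have : P.side = 2 * ρ := rfl
            rw [this, mul_pow, hρdef, ← Real.rpow_natCast (L ^ η), ← Real.rpow_mul hL0.le,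
              mul_comm η]
          calc L ^ (2 / t * q) * P.side ^ n = 2 ^ n * L ^ (n * η + 2 / t * q) := by
                rw [hPs, Real.rpow_add hL0]; ring
            _ ≤ 2 ^ n * L ^ (1 / 2 : ℝ) := by
                gcongr
            _ ≤ 2 ^ n * (Real.sqrt C₂ * Q.side ^ n) := by
                gcongr
                rw [← Real.sqrt_eq_rpow, ← Real.sqrt_sq hS.le, ← Real.sqrt_mul hC₂]
                exact Real.sqrt_le_sqrt hlQ'
            _ = _ := by ring

lemma abs_log_le_of_bounds {l c C s T : ℝ} {N : ℕ} (hl : 0 < l) (hc : 0 < c) (hC : 1 ≤ C)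
    (hs : 0 < s) (hT : 1 ≤ T) (h1 : c * (s / T) ^ N ≤ l) (h2 : l ≤ C * T ^ N) :
    |Real.log l| ≤ |Real.log c| + Real.log C + N * Real.log T + N * |Real.log s| := by
  have hT0 : 0 < T := by linarith
  have hC0 : 0 < C := by linarith
  have e1 := Real.log_le_log (by positivity) h1
  have e2 := Real.log_le_log hl h2
  rw [Real.log_mul hc.ne' (by positivity), Real.log_pow, Real.log_div hs.ne' hT0.ne'] at e1
  rw [Real.log_mul hC0.ne' (by positivity), Real.log_pow] at e2
  have := Real.log_nonneg hC
  have hN : (0 : ℝ) ≤ N := Nat.cast_nonneg N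
  have h3 : 0 ≤ N * Real.log T := mul_nonneg hN (Real.log_nonneg hT)
  have h4 : -(N * |Real.log s|) ≤ N * Real.log s := by
    rw [← mul_neg]; gcongr; exact neg_abs_le _
  have h5 : 0 ≤ N * |Real.log s| := by positivity
  have h6 := neg_abs_le (Real.log c)
  have h7 := abs_nonneg (Real.log c)
  rw [mul_sub] at e1
  rw [abs_le]
  constructor <;> linarith

lemma half_le_log_two_add {m : ℝ} (hm : 0 ≤ m) : 1 / 2 ≤ Real.log (2 + m) := by
  have h1 := Real.log_two_gt_d9
  have h2 : Real.log 2 ≤ Real.log (2 + m) := Real.log_le_log (by norm_num) (by linarith)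
  linarith

lemma mul_bound_of_logs {D Λ B N L S C : ℝ} (hD : 0 ≤ D) (hN : 0 ≤ N) (hB : 0 ≤ B)
    (hΛ : Λ ≤ B + N * L + N * S) (hL : 1 / 2 ≤ L) (h1 : D * L ≤ C) (h2 : D * S ≤ C) :
    Λ * D ≤ 2 * B * C + 2 * N * C := by
  have h3 : D ≤ 2 * C := by nlinarith
  calc Λ * D ≤ (B + N * L + N * S) * D := by gcongr
    _ = B * D + N * (D * L) + N * (D * S) := by ring
    _ ≤ B * (2 * C) + N * C + N * C := by gcongr
    _ = _ := by ring

section Cases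

variable {n : ℕ} {e : Rn n → ℝ} {G : Set (Rn n)} {q C₀ c C₁ : ℝ} {l : Cube n → ℝ}

lemma pointwise_bound_of_small
    (hC₀ : 0 ≤ C₀) (hG : ∀ᵐ x, x ∈ G) (hc : 0 < c) (hC₁ : 1 ≤ C₁)
    (hLH0 : ∀ x ∈ G, ∀ y ∈ G, dist x y < 1 / 2 → |e x - e y| ≤ C₀ / (-Real.log (dist x y)))
    (hLH : ∀ x ∈ G, |e x - q| * Real.log (Real.exp 1 + ‖x‖) ≤ C₀)
    {Q : Cube n} (hl : 0 < l Q) (hl1 : c * (Q.side / Q.hull) ^ (2 * n) ≤ l Q)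
    (hl2 : l Q ≤ C₁ * Q.hull ^ (2 * n)) (hside : Q.side ≤ 1 / 4) :
    ∃ q', ∀ᵐ x, x ∈ Q.toSet → |Real.log (l Q)| * |e x - q'| ≤
      2 * (|Real.log c| + Real.log C₁) * (2 * C₀) + 2 * (2 * n) * (2 * C₀) := by
  have hs := Q.side_pos
  obtain ⟨x₀, hx₀Q, hx₀⟩ : ∃ x ∈ Q.toSet, x ∈ G := by
    by_contra! hcon
    have : volume Q.toSet = 0 := by
      refine measure_mono_null (fun x hx => ?_) (ae_iff.1 hG)
      exact hcon x hx
    rw [Q.volume_toSet, ENNReal.ofReal_eq_zero] at this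
    linarith [Q.measure_pos]
  refine ⟨e x₀, hG.mono fun x hx hxQ => ?_⟩
  have hm := norm_nonneg Q.base
  set m := ‖Q.base‖ with hmdef
  have hlogs : Real.log Q.side < 0 := Real.log_neg hs (by linarith)
  have hnorm : ∀ y ∈ Q.toSet, y ∈ G → |e y - q| * Real.log (2 + m) ≤ C₀ := by
    intro y hy hyG
    refine le_trans ?_ (hLH y hyG)
    have h1 : 2 + m ≤ Real.exp 1 + ‖y‖ := by
      have h1 := Q.le_norm hy
      have h2 := Real.exp_one_gt_d9
      linarith
    gcongr
  have hT : Q.hull ≤ 2 + m := by unfold Cube.hull; linarith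
  have hL := half_le_log_two_add hm
  have hlog := abs_log_le_of_bounds hl hc hC₁ hs Q.one_le_hull hl1 hl2
  have hTlog : Real.log Q.hull ≤ Real.log (2 + m) := Real.log_le_log Q.hull_pos hT
  refine mul_bound_of_logs (L := Real.log (2 + m)) (S := |Real.log Q.side|) (abs_nonneg _)
    (by positivity) (by have := Real.log_nonneg hC₁; positivity) ?_ hL ?_ ?_
  · refine hlog.trans ?_
    push_cast
    gcongr
  · have h1 := hnorm x hxQ hx
    have h2 := hnorm x₀ hx₀Q hx₀
    have h3 : |e x - e x₀| ≤ |e x - q| + |e x₀ - q| := by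
      rw [abs_sub_comm (e x₀)]; exact abs_sub_le _ _ _
    calc |e x - e x₀| * Real.log (2 + m) ≤ (|e x - q| + |e x₀ - q|) * Real.log (2 + m) := by
          gcongr
      _ ≤ 2 * C₀ := by linarith
  · rw [abs_of_neg hlogs]
    have hd := Q.dist_le hxQ hx₀Q
    rcases (dist_nonneg (x := x) (y := x₀)).eq_or_lt with h0 | h0
    · rw [dist_eq_zero.1 h0.symm, sub_self, abs_zero, zero_mul]; linarith
    · have h1 := hLH0 x hx x₀ hx₀ (by linarith)
      have h2 : Real.log (dist x x₀) ≤ Real.log Q.side := Real.log_le_log h0 hd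
      rw [le_div_iff₀ (by linarith)] at h1
      calc |e x - e x₀| * -Real.log Q.side ≤ |e x - e x₀| * -Real.log (dist x x₀) := by
            gcongr
        _ ≤ 2 * C₀ := by linarith

lemma pointwise_bound_of_far
    (hG : ∀ᵐ x, x ∈ G) (hc : 0 < c) (hC₁ : 1 ≤ C₁)
    (hLH : ∀ x ∈ G, |e x - q| * Real.log (Real.exp 1 + ‖x‖) ≤ C₀)
    {Q : Cube n} (hl : 0 < l Q) (hl1 : c * (Q.side / Q.hull) ^ (2 * n) ≤ l Q)
    (hl2 : l Q ≤ C₁ * Q.hull ^ (2 * n)) (hside : 1 / 4 < Q.side)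
    (hfar : 2 * Q.side ≤ ‖Q.base‖) :
    ∀ᵐ x, x ∈ Q.toSet → |Real.log (l Q)| * |e x - q| ≤
      2 * (|Real.log c| + Real.log C₁) * (2 * C₀) + 2 * (4 * n) * (2 * C₀) := by
  have hs := Q.side_pos
  refine hG.mono fun x hx hxQ => ?_
  have hm := norm_nonneg Q.base
  set m := ‖Q.base‖ with hmdef
  have hexp := Real.exp_one_gt_d9
  have hL := half_le_log_two_add hm
  have hT : Q.hull ≤ (2 + m) ^ 2 := by unfold Cube.hull; nlinarith
  have hlog := abs_log_le_of_bounds hl hc hC₁ hs Q.one_le_hull hl1 hl2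
  have hTlog : Real.log Q.hull ≤ 2 * Real.log (2 + m) := by
    have := Real.log_le_log Q.hull_pos hT
    rwa [Real.log_pow] at this
  have hslog : |Real.log Q.side| ≤ 2 * Real.log (2 + m) := by
    rw [abs_le]
    constructor
    · have h1 : ((2 + m) ^ 2)⁻¹ ≤ Q.side := by
        rw [inv_le_iff_one_le_mul₀ (by positivity)]; nlinarith
      have := Real.log_le_log (by positivity) h1
      rw [Real.log_inv, Real.log_pow] at this
      exact_mod_cast this
    · have : Real.log Q.side ≤ Real.log (2 + m) := Real.log_le_log hs (by linarith)
      linarith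
  have hx1 : |e x - q| * Real.log (2 + m) ≤ 2 * C₀ := by
    have h1 : Real.log (2 + m) ≤ 2 * Real.log (Real.exp 1 + ‖x‖) := by
      have h2 := Q.le_norm hxQ
      have h3 : 2 + m ≤ (Real.exp 1 + ‖x‖) ^ 2 := by
        have : 2 + m / 2 ≤ Real.exp 1 + ‖x‖ := by linarith
        nlinarith
      have := Real.log_le_log (by positivity) h3
      rwa [Real.log_pow] at this
    calc |e x - q| * Real.log (2 + m) ≤ |e x - q| * (2 * Real.log (Real.exp 1 + ‖x‖)) := by
          gcongr
      _ ≤ 2 * C₀ := by linarith [hLH x hx]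
  refine mul_bound_of_logs (L := Real.log (2 + m)) (S := Real.log (2 + m)) (abs_nonneg _)
    (by positivity) (by have := Real.log_nonneg hC₁; positivity) ?_ hL hx1 hx1
  refine hlog.trans ?_
  push_cast
  calc |Real.log c| + Real.log C₁ + 2 * n * Real.log Q.hull + 2 * n * |Real.log Q.side|
      ≤ |Real.log c| + Real.log C₁ + 2 * n * (2 * Real.log (2 + m)) +
        2 * n * (2 * Real.log (2 + m)) := by gcongr
    _ = _ := by ring

lemma pointwise_or_large_of_near
    (hG : ∀ᵐ x, x ∈ G) (hc : 0 < c) (hC₁ : 1 ≤ C₁)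
    (hLH : ∀ x ∈ G, |e x - q| * Real.log (Real.exp 1 + ‖x‖) ≤ C₀)
    {Q : Cube n} (hl : 0 < l Q) (hl1 : c * (Q.side / Q.hull) ^ (2 * n) ≤ l Q)
    (hl2 : l Q ≤ C₁ * Q.hull ^ (2 * n)) (hside : 1 / 4 < Q.side)
    (hnear : ‖Q.base‖ < 2 * Q.side) :
    (∀ᵐ x, x ∈ Q.toSet → |Real.log (l Q)| * |e x - q| ≤
      |Real.log (c * (1 / 7) ^ (2 * n))| * C₀) ∨
    (1 ≤ l Q ∧ l Q ≤ C₁ * 7 ^ (2 * n) * (Q.side ^ n) ^ 2) := by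
  have hs := Q.side_pos
  have hT : Q.hull ≤ 7 * Q.side := by unfold Cube.hull; linarith
  have hT0 := Q.hull_pos
  rcases le_total 1 (l Q) with h1 | h1
  · right
    refine ⟨h1, hl2.trans ?_⟩
    calc C₁ * Q.hull ^ (2 * n) ≤ C₁ * (7 * Q.side) ^ (2 * n) := by gcongr
      _ = _ := by rw [mul_pow, ← pow_mul, mul_comm n 2]; ring
  · left
    refine hG.mono fun x hx hxQ => ?_
    have h2 : c * (1 / 7) ^ (2 * n) ≤ l Q := by
      have h3 : 1 / 7 ≤ Q.side / Q.hull := by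
        rw [div_le_div_iff₀ (by norm_num) hT0]; linarith
      refine le_trans ?_ hl1
      gcongr
    have h3 := Real.log_le_log (by positivity) h2
    have h4 := Real.log_nonpos hl.le h1
    have h5 : |e x - q| ≤ C₀ := by
      refine le_trans ?_ (hLH x hx)
      apply le_mul_of_one_le_right (abs_nonneg _)
      rw [Real.le_log_iff_exp_le (by positivity)]
      linarith [norm_nonneg x]
    rw [abs_of_nonpos h4, abs_of_nonpos (h3.trans h4)]
    have h6 : 0 ≤ -Real.log (c * (1 / 7) ^ (2 * n)) := by linarith
    gcongr

end Cases

/-- A weight with a Muckenhoupt type bound for a log-Hölder continuous exponent gives an `A_∞`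
weight. -/
theorem muckAinf_rpow_of_cubeBound {n : ℕ} {f e : Rn n → ℝ} {G : Set (Rn n)} {A b q C₀ : ℝ}
    {l M : Cube n → ℝ} {g : Cube n → Rn n → ℝ}
    (hfm : Measurable f) (hem : Measurable e) (hf : ∀ᵐ x, 0 < f x)
    (he : ∀ᵐ x, 1 / 2 < e x ∧ e x ≤ b) (hA : 1 ≤ A) (hb : 0 < b) (hq : 0 < q) (hC₀ : 0 ≤ C₀)
    (hG : ∀ᵐ x, x ∈ G)
    (hLH0 : ∀ x ∈ G, ∀ y ∈ G, dist x y < 1 / 2 → |e x - e y| ≤ C₀ / (-Real.log (dist x y)))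
    (hLH : ∀ x ∈ G, |e x - q| * Real.log (Real.exp 1 + ‖x‖) ≤ C₀)
    (hQ : ∀ Q, CubeBound f e A Q (l Q) (M Q) (g Q)) :
    MuckAinf fun x => f x ^ e x := by
  obtain ⟨c, C₁, hc, hC₁, hl⟩ := exists_polynomial_bounds hf (he.mono fun x hx => hx.1) hfm hem
    (by linarith) hQ
  set t : ℝ := 4 * b + 8 * q + 2 with ht
  have ht0 : 0 < t := by positivity
  obtain ⟨η, hη, hηb, hηt⟩ : ∃ η : ℝ, 0 < η ∧ η * (2 * n * b) ≤ q ∧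
      n * η + 2 / t * q ≤ 1 / 2 := by
    have hn : (0 : ℝ) ≤ n := Nat.cast_nonneg n
    refine ⟨min (q / (2 * n * b + 1)) (1 / (4 * n + 1)), by positivity, ?_, ?_⟩
    · calc min (q / (2 * n * b + 1)) (1 / (4 * n + 1)) * (2 * n * b)
          ≤ q / (2 * n * b + 1) * (2 * n * b + 1) := by
            gcongr
            · exact min_le_left _ _
            · linarith
        _ = q := by field_simp
    · have h1 : n * min (q / (2 * n * b + 1)) (1 / (4 * n + 1)) ≤ 1 / 4 := by
        calc n * min (q / (2 * n * b + 1)) (1 / (4 * n + 1)) ≤ n * (1 / (4 * n + 1)) := by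
              gcongr; exact min_le_right _ _
          _ ≤ 1 / 4 := by
              rw [mul_one_div, div_le_div_iff₀ (by positivity) (by norm_num)]; linarith
      have h2 : 2 / t * q ≤ 1 / 4 := by
        rw [div_mul_eq_mul_div, div_le_div_iff₀ ht0 (by norm_num)]; linarith
      linarith
  set K₁ := 2 * (|Real.log c| + Real.log C₁) * (2 * C₀) + 2 * (4 * n) * (2 * C₀) +
    |Real.log (c * (1 / 7) ^ (2 * n))| * C₀ with hK₁
  set K := Real.exp K₁ + Real.exp (C₀ / η) + (C₁ * 4 ^ (2 * n)) ^ b +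
    2 ^ n * Real.sqrt (C₁ * 7 ^ (2 * n)) with hK
  have hlogC := Real.log_nonneg hC₁
  have hK0 : 0 ≤ K := by positivity
  refine ⟨t + 1, by linarith, ENNReal.ofReal (K * A ^ b * (3 + K) ^ t), ENNReal.ofReal_ne_top,
    fun Q => ?_⟩
  have hexp : 1 - (t + 1) / (t + 1 - 1) = -(1 / t) := by
    rw [add_sub_cancel_right]; field_simp; ring
  rw [hexp, add_sub_cancel_right]
  have hlp := (hQ Q).lam_pos
  have hS := Q.measure_pos
  have main : (∃ q', ∀ᵐ x, x ∈ Q.toSet → |Real.log (l Q)| * |e x - q'| ≤ K₁) ∨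
      (1 ≤ l Q ∧ l Q ≤ C₁ * 7 ^ (2 * n) * (Q.side ^ n) ^ 2) := by
    have p1 : 0 ≤ 2 * (|Real.log c| + Real.log C₁) * (2 * C₀) := by positivity
    have p2 : 0 ≤ (n : ℝ) * C₀ := by positivity
    have p3 : 0 ≤ |Real.log (c * (1 / 7) ^ (2 * n))| * C₀ := by positivity
    rcases le_or_gt Q.side (1 / 4) with h1 | h1
    · obtain ⟨q', hq'⟩ := pointwise_bound_of_small hC₀ hG hc hC₁ hLH0 hLH hlp (hl Q).1 (hl Q).2 h1
      exact Or.inl ⟨q', hq'.mono fun x hx hxQ => (hx hxQ).trans (by linarith)⟩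
    · rcases le_or_gt (2 * Q.side) ‖Q.base‖ with h2 | h2
      · exact Or.inl ⟨q, (pointwise_bound_of_far hG hc hC₁ hLH hlp (hl Q).1 (hl Q).2 h1 h2).mono
          fun x hx hxQ => (hx hxQ).trans (by linarith)⟩
      · refine (pointwise_or_large_of_near hG hc hC₁ hLH hlp (hl Q).1 (hl Q).2 h1 h2).imp_left
          fun h => ⟨q, h.mono fun x hx hxQ => (hx hxQ).trans (by linarith)⟩
  obtain ⟨q', hW, hdual⟩ : ∃ q' : ℝ,
      ∫⁻ x in Q.toSet, ENNReal.ofReal (f x ^ e x) ≤ ENNReal.ofReal (K * l Q ^ q') ∧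
      ∫⁻ x in Q.toSet, ENNReal.ofReal (l Q ^ (2 / t * (q' - e x))) ≤
        ENNReal.ofReal (K * Q.side ^ n) := by
    have p1 := Real.exp_pos K₁
    have p2 := Real.exp_pos (C₀ / η)
    have p3 : 0 ≤ (C₁ * 4 ^ (2 * n)) ^ b := by positivity
    have p4 : 0 ≤ 2 ^ n * Real.sqrt (C₁ * 7 ^ (2 * n)) := by positivity
    rcases main with ⟨q', h⟩ | ⟨h1, h2⟩
    · obtain ⟨hW, hdual⟩ := integral_bounds_of_pointwise (t := t) hf (by linarith) (hQ Q) h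
      refine ⟨q', hW.trans ?_, hdual.trans ?_⟩ <;> apply ENNReal.ofReal_le_ofReal <;> gcongr <;>
        linarith
    · obtain ⟨hW, hdual⟩ := integral_bounds_of_one_le hf he hfm hem (by linarith) hη hηb hηt
        hQ hC₁ (fun Q => (hl Q).2) (hG.mono hLH) h1 (by positivity) h2
      refine ⟨q, hW.trans ?_, hdual.trans ?_⟩ <;> apply ENNReal.ofReal_le_ofReal <;> gcongr <;>
        linarith
  exact muckenhoupt_product_le hf he hem hA (by linarith) hb hK0 (hQ Q) hW hdual

/-- A triple of weights with product one satisfying a joint Muckenhoupt condition for exponents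
whose reciprocals sum to two: the condition is symmetric in the three weights. -/
theorem muckAinf_of_triple {n : ℕ} {f₀ f₁ f₂ e₀ e₁ e₂ : Rn n → ℝ} {b A : ℝ}
    (hf₀m : Measurable f₀) (hf₁m : Measurable f₁) (hf₂m : Measurable f₂)
    (he₀m : Measurable e₀) (he₁m : Measurable e₁) (he₂m : Measurable e₂)
    (hf : ∀ᵐ x, 0 < f₀ x ∧ 0 < f₁ x ∧ 0 < f₂ x ∧ f₀ x * f₁ x * f₂ x = 1)
    (he₀ : ∀ᵐ x, 1 / 2 < e₀ x ∧ e₀ x ≤ b) (hb : 0 < b)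
    (he : ∀ᵐ x, 0 < e₁ x ∧ 0 < e₂ x ∧ 1 / e₀ x + 1 / e₁ x + 1 / e₂ x = 2)
    (hLH0 : LH0 e₀)
    (hLH : ∃ C > 0, ∃ ρ : ℝ, ∀ x, |1 / e₀ x - ρ| ≤ C / Real.log (Real.exp 1 + ‖x‖))
    (hQ : ∀ Q : Cube n, ∃ l₀ l₁ l₂ : ℝ, 0 < l₀ ∧ 0 < l₁ ∧ 0 < l₂ ∧
      ∫⁻ x in Q.toSet, ENNReal.ofReal ((f₀ x / l₀) ^ e₀ x) ≤ 1 ∧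
      ∫⁻ x in Q.toSet, ENNReal.ofReal ((f₁ x / l₁) ^ e₁ x) ≤ 1 ∧
      ∫⁻ x in Q.toSet, ENNReal.ofReal ((f₂ x / l₂) ^ e₂ x) ≤ 1 ∧
      l₀ * l₁ * l₂ ≤ A * (Q.side ^ n) ^ 2) :
    MuckAinf fun x => f₀ x ^ e₀ x := by
  choose l₀ l₁ l₂ hl₀ hl₁ hl₂ hI₀ hI₁ hI₂ hl using hQ
  obtain ⟨C, hC, hLH0⟩ := hLH0
  obtain ⟨C', hC', ρ, hLH⟩ := hLH
  set ρ' := max ρ (1 / b) with hρ'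
  have hρ'b : 1 / b ≤ ρ' := le_max_right _ _
  have hρ'0 : 0 < ρ' := (by positivity : 0 < 1 / b).trans_le hρ'b
  have hinv : 1 / ρ' ≤ b := by rwa [one_div_le hρ'0 hb]
  have hdiff : ∀ {u v D : ℝ}, 0 < u → u ≤ b → 0 < v → v ≤ b → |1 / u - 1 / v| ≤ D →
      |u - v| ≤ b ^ 2 * D := by
    intro u v D hu hub hv hvb h
    have h1 : u - v = -(u * v) * (1 / u - 1 / v) := by field_simp; ring
    rw [h1, abs_mul, abs_neg, abs_of_pos (mul_pos hu hv), pow_two]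
    gcongr
  refine muckAinf_rpow_of_cubeBound (G := {x | 1 / 2 < e₀ x ∧ e₀ x ≤ b}) (A := max 1 A) (b := b)
    (q := 1 / ρ') (C₀ := b ^ 2 * (C + C')) (l := l₀) (M := fun Q => l₁ Q * l₂ Q)
    (g := fun Q x => (f₁ x / l₁ Q) ^ e₁ x + (f₂ x / l₂ Q) ^ e₂ x)
    hf₀m he₀m (hf.mono fun x hx => hx.1) he₀ (le_max_left _ _) hb (by positivity) (by positivity)
    he₀ ?_ ?_ ?_
  · rintro x ⟨hx1, hx2⟩ y ⟨hy1, hy2⟩ hxy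
    refine (hdiff (by linarith) hx2 (by linarith) hy2 (hLH0 x y hxy)).trans ?_
    rw [← mul_div_assoc]
    have hlog : 0 ≤ -Real.log (dist x y) := by
      rw [neg_nonneg]
      exact Real.log_nonpos dist_nonneg (by linarith)
    gcongr
    linarith
  · rintro x ⟨hx1, hx2⟩
    have hx0 : 0 < e₀ x := by linarith
    have hlog : 0 < Real.log (Real.exp 1 + ‖x‖) := by
      apply Real.log_pos
      have := Real.exp_one_gt_d9
      linarith [norm_nonneg x]
    have h1 : |1 / e₀ x - 1 / (1 / ρ')| ≤ C' / Real.log (Real.exp 1 + ‖x‖) := by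
      rw [one_div_one_div]
      refine le_trans ?_ (hLH x)
      have h2 : 1 / e₀ x = max (1 / e₀ x) (1 / b) :=
        (max_eq_left (one_div_le_one_div_of_le hx0 hx2)).symm
      rw [hρ']
      nth_rw 1 [h2]
      exact abs_max_sub_max_le_abs _ _ _
    have h2 := hdiff hx0 hx2 (by positivity) hinv h1
    rw [← mul_div_assoc, le_div_iff₀ hlog] at h2
    refine h2.trans ?_
    gcongr
    linarith
  · intro Q
    have h₁ := hl₁ Q
    have h₂ := hl₂ Q
    refine ⟨hl₀ Q, mul_pos h₁ h₂, ?_, by fun_prop, hI₀ Q, ?_, ?_, ?_⟩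
    · filter_upwards [hf] with x ⟨_, h3, h4, _⟩
      positivity
    · calc ∫⁻ x in Q.toSet, ENNReal.ofReal ((f₁ x / l₁ Q) ^ e₁ x + (f₂ x / l₂ Q) ^ e₂ x)
          ≤ ∫⁻ x in Q.toSet, (ENNReal.ofReal ((f₁ x / l₁ Q) ^ e₁ x) +
              ENNReal.ofReal ((f₂ x / l₂ Q) ^ e₂ x)) :=
            lintegral_mono fun x => ENNReal.ofReal_add_le
        _ ≤ 1 + 1 := by
            rw [lintegral_add_left (by fun_prop)]
            exact add_le_add (hI₁ Q) (hI₂ Q)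
        _ = 2 := one_add_one_eq_two
    · filter_upwards [hf, he] with x ⟨h3, h4, h5, h6⟩ ⟨h7, h8, h9⟩
      set F₁ := (f₁ x / l₁ Q) ^ e₁ x with hF₁
      set F₂ := (f₂ x / l₂ Q) ^ e₂ x with hF₂
      have hF₁0 : 0 < F₁ := by positivity
      have hF₂0 : 0 < F₂ := by positivity
      have k₁ : F₁ ^ (1 / e₁ x) = f₁ x / l₁ Q := by
        rw [hF₁, ← Real.rpow_mul (by positivity), mul_one_div_cancel h7.ne', Real.rpow_one]
      have k₂ : F₂ ^ (1 / e₂ x) = f₂ x / l₂ Q := by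
        rw [hF₂, ← Real.rpow_mul (by positivity), mul_one_div_cancel h8.ne', Real.rpow_one]
      have hexp : 2 - 1 / e₀ x = 1 / e₁ x + 1 / e₂ x := by linarith
      rw [hexp, Real.rpow_add (by positivity)]
      calc 1 = f₀ x * (l₁ Q * l₂ Q) * (F₁ ^ (1 / e₁ x) * F₂ ^ (1 / e₂ x)) := by
            rw [k₁, k₂, ← h6]; field_simp
        _ ≤ _ := by
            have i₁ : F₁ ≤ F₁ + F₂ := by linarith
            have i₂ : F₂ ≤ F₁ + F₂ := by linarith
            gcongr
    · calc l₀ Q * (l₁ Q * l₂ Q) = l₀ Q * l₁ Q * l₂ Q := by ring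
        _ ≤ A * (Q.side ^ n) ^ 2 := hl Q
        _ ≤ _ := by gcongr; exact le_max_right _ _

lemma setLIntegral_le_one_of_vNorm_lt {n : ℕ} {r : Rn n → ℝ≥0∞} {e φ : Rn n → ℝ} {Q : Cube n}
    {l : ℝ} (hr : ∀ᵐ x, r x = ENNReal.ofReal (e x)) (he : ∀ᵐ x, 1 / 2 < e x)
    (hφ : ∀ᵐ x, 0 < φ x) (hl : 0 < l)
    (h : vNorm r (Q.toSet.indicator φ) < ENNReal.ofReal l) :
    ∫⁻ x in Q.toSet, ENNReal.ofReal ((φ x / l) ^ e x) ≤ 1 := by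
  obtain ⟨m, ⟨hm0, hm⟩, hml⟩ := sInf_lt_iff.1 h
  have hset : ∀ᵐ x ∂(volume : Measure (Rn n)), x ∈ {x | r x ≠ ∞} := by
    filter_upwards [hr] with x hx
    simp [hx]
  have h1 := (le_self_add.trans hm)
  rw [Measure.restrict_eq_self_of_ae_mem hset] at h1
  refine le_trans ?_ h1
  rw [← lintegral_indicator Q.measurableSet_toSet]
  apply lintegral_mono_ae
  filter_upwards [hr, he, hφ] with x h2 h3 h4
  by_cases hx : x ∈ Q.toSet
  · rw [indicator_of_mem hx, indicator_of_mem hx, h2, ENNReal.toReal_ofReal (by linarith),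
      abs_of_pos h4, ← ENNReal.ofReal_rpow_of_pos (by positivity), ENNReal.ofReal_div_of_pos hl]
    gcongr
  · rw [indicator_of_notMem hx]
    exact zero_le

lemma vNorm_indicator_ne_zero {n : ℕ} {r : Rn n → ℝ≥0∞} {e φ : Rn n → ℝ} {Q : Cube n}
    (hr : ∀ᵐ x, r x = ENNReal.ofReal (e x)) (he : ∀ᵐ x, 1 / 2 < e x)
    (hφ : ∀ᵐ x, 0 < φ x) (hem : Measurable e) (hφm : Measurable φ) :
    vNorm r (Q.toSet.indicator φ) ≠ 0 := by
  intro h0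
  set I := ∫⁻ x in Q.toSet, ENNReal.ofReal (φ x ^ e x) with hI
  have key : ∀ l : ℝ, 0 < l → l ≤ 1 → I ≤ ENNReal.ofReal (l ^ (1 / 2 : ℝ)) := by
    intro l hl hl1
    have h1 := setLIntegral_le_one_of_vNorm_lt (l := l) hr he hφ hl
      (by rw [h0]; exact ENNReal.ofReal_pos.2 hl)
    calc I ≤ ∫⁻ x in Q.toSet, ENNReal.ofReal (l ^ (1 / 2 : ℝ)) *
            ENNReal.ofReal ((φ x / l) ^ e x) := by
          apply lintegral_mono_ae
          filter_upwards [ae_restrict_of_ae he, ae_restrict_of_ae hφ] with x h2 h3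
          rw [← ENNReal.ofReal_mul (by positivity)]
          apply ENNReal.ofReal_le_ofReal
          have h4 : φ x ^ e x = l ^ e x * (φ x / l) ^ e x := by
            rw [← Real.mul_rpow hl.le (by positivity)]
            congr 1; field_simp
          rw [h4]
          have h5 : l ^ e x ≤ l ^ (1 / 2 : ℝ) := Real.rpow_le_rpow_of_exponent_ge hl hl1 h2.le
          gcongr
      _ = ENNReal.ofReal (l ^ (1 / 2 : ℝ)) *
            ∫⁻ x in Q.toSet, ENNReal.ofReal ((φ x / l) ^ e x) :=
          lintegral_const_mul' _ _ ENNReal.ofReal_ne_top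
      _ ≤ ENNReal.ofReal (l ^ (1 / 2 : ℝ)) * 1 := by gcongr
      _ = _ := mul_one _
  have hI0 : I = 0 := by
    by_contra hne
    have htop : I ≠ ∞ := ne_top_of_le_ne_top ENNReal.ofReal_ne_top (key 1 one_pos le_rfl)
    have hpos : 0 < I.toReal := ENNReal.toReal_pos hne htop
    set m := min (I.toReal / 2) 1 with hm
    have hm0 : 0 < m := by positivity
    have h1 := key (m ^ 2) (by positivity) (pow_le_one₀ hm0.le (min_le_right _ _))
    rw [← Real.sqrt_eq_rpow, Real.sqrt_sq hm0.le, ← ENNReal.ofReal_toReal htop,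
      ENNReal.ofReal_le_ofReal_iff hm0.le] at h1
    have : m ≤ I.toReal / 2 := min_le_left _ _
    linarith
  rw [hI, lintegral_eq_zero_iff (by fun_prop)] at hI0
  have hfalse : ∀ᵐ x ∂(volume.restrict Q.toSet), False := by
    filter_upwards [hI0, ae_restrict_of_ae hφ] with x h1 h2
    have h3 : 0 < φ x ^ e x := Real.rpow_pos_of_pos h2 _
    rw [Pi.zero_apply, ENNReal.ofReal_eq_zero] at h1
    linarith
  rw [ae_restrict_iff' Q.measurableSet_toSet] at hfalse
  have : volume Q.toSet = 0 := by
    refine measure_mono_null (fun x hx => ?_) (ae_iff.1 hfalse)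
    simpa using hx
  rw [Q.volume_toSet, ENNReal.ofReal_eq_zero] at this
  linarith [Q.measure_pos]

lemma exists_levels_of_product_le {n : ℕ} {r₀ r₁ r₂ : Rn n → ℝ≥0∞}
    {e₀ e₁ e₂ f₀ f₁ f₂ : Rn n → ℝ} {C : ℝ≥0∞} {Q : Cube n}
    (hr₀ : ∀ᵐ x, r₀ x = ENNReal.ofReal (e₀ x)) (hr₁ : ∀ᵐ x, r₁ x = ENNReal.ofReal (e₁ x))
    (hr₂ : ∀ᵐ x, r₂ x = ENNReal.ofReal (e₂ x))
    (he₀ : ∀ᵐ x, 1 / 2 < e₀ x) (he₁ : ∀ᵐ x, 1 / 2 < e₁ x) (he₂ : ∀ᵐ x, 1 / 2 < e₂ x)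
    (hf₀ : ∀ᵐ x, 0 < f₀ x) (hf₁ : ∀ᵐ x, 0 < f₁ x) (hf₂ : ∀ᵐ x, 0 < f₂ x)
    (he₀m : Measurable e₀) (he₁m : Measurable e₁) (he₂m : Measurable e₂)
    (hf₀m : Measurable f₀) (hf₁m : Measurable f₁) (hf₂m : Measurable f₂)
    (hC : C ≠ ∞)
    (h : Q.vol⁻¹ ^ 2 * vNorm r₀ (Q.toSet.indicator f₀) * vNorm r₁ (Q.toSet.indicator f₁) *
      vNorm r₂ (Q.toSet.indicator f₂) ≤ C) :
    ∃ l₀ l₁ l₂ : ℝ, 0 < l₀ ∧ 0 < l₁ ∧ 0 < l₂ ∧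
      ∫⁻ x in Q.toSet, ENNReal.ofReal ((f₀ x / l₀) ^ e₀ x) ≤ 1 ∧
      ∫⁻ x in Q.toSet, ENNReal.ofReal ((f₁ x / l₁) ^ e₁ x) ≤ 1 ∧
      ∫⁻ x in Q.toSet, ENNReal.ofReal ((f₂ x / l₂) ^ e₂ x) ≤ 1 ∧
      l₀ * l₁ * l₂ ≤ 8 * C.toReal * (Q.side ^ n) ^ 2 := by
  have z₀ := vNorm_indicator_ne_zero (Q := Q) hr₀ he₀ hf₀ he₀m hf₀m
  have z₁ := vNorm_indicator_ne_zero (Q := Q) hr₁ he₁ hf₁ he₁m hf₁m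
  have z₂ := vNorm_indicator_ne_zero (Q := Q) hr₂ he₂ hf₂ he₂m hf₂m
  have s₀ := fun l => setLIntegral_le_one_of_vNorm_lt (Q := Q) (l := l) hr₀ he₀ hf₀
  have s₁ := fun l => setLIntegral_le_one_of_vNorm_lt (Q := Q) (l := l) hr₁ he₁ hf₁
  have s₂ := fun l => setLIntegral_le_one_of_vNorm_lt (Q := Q) (l := l) hr₂ he₂ hf₂
  set N₀ := vNorm r₀ (Q.toSet.indicator f₀)
  set N₁ := vNorm r₁ (Q.toSet.indicator f₁)
  set N₂ := vNorm r₂ (Q.toSet.indicator f₂)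
  have hS := Q.measure_pos
  have hvol : Q.vol⁻¹ = ENNReal.ofReal (Q.side ^ n)⁻¹ := by
    rw [Cube.vol, ENNReal.ofReal_inv_of_pos hS]
  rw [hvol, ← ENNReal.ofReal_pow (by positivity)] at h
  set v := ENNReal.ofReal ((Q.side ^ n)⁻¹ ^ 2) with hv
  have hv0 : v ≠ 0 := (ENNReal.ofReal_pos.2 (by positivity)).ne'
  have hprod := ne_top_of_le_ne_top hC h
  have t₂ : N₂ ≠ ∞ := fun hN => hprod (by
    rw [hN]; exact ENNReal.mul_top (mul_ne_zero (mul_ne_zero hv0 z₀) z₁))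
  have hprod₁ : v * N₀ * N₁ ≠ ∞ := fun hN => hprod (by rw [hN]; exact ENNReal.top_mul z₂)
  have t₁ : N₁ ≠ ∞ := fun hN => hprod₁ (by
    rw [hN]; exact ENNReal.mul_top (mul_ne_zero hv0 z₀))
  have hprod₀ : v * N₀ ≠ ∞ := fun hN => hprod₁ (by rw [hN]; exact ENNReal.top_mul z₁)
  have t₀ : N₀ ≠ ∞ := fun hN => hprod₀ (by rw [hN]; exact ENNReal.mul_top hv0)
  have hlt : ∀ {N : ℝ≥0∞}, N ≠ 0 → N ≠ ∞ →
      0 < 2 * N.toReal ∧ N < ENNReal.ofReal (2 * N.toReal) := by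
    intro N h0 ht
    have hp := ENNReal.toReal_pos h0 ht
    refine ⟨by positivity, (ENNReal.lt_ofReal_iff_toReal_lt ht).2 (by linarith)⟩
  obtain ⟨a₀, b₀⟩ := hlt z₀ t₀
  obtain ⟨a₁, b₁⟩ := hlt z₁ t₁
  obtain ⟨a₂, b₂⟩ := hlt z₂ t₂
  refine ⟨_, _, _, a₀, a₁, a₂, s₀ _ a₀ b₀, s₁ _ a₁ b₁, s₂ _ a₂ b₂, ?_⟩
  have hreal := ENNReal.toReal_mono hC h
  rw [ENNReal.toReal_mul, ENNReal.toReal_mul, ENNReal.toReal_mul, hv,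
    ENNReal.toReal_ofReal (by positivity), inv_pow, mul_assoc, mul_assoc,
    inv_mul_le_iff₀ (by positivity)] at hreal
  linarith

lemma conjExp_eq_ofReal {n : ℕ} {p : Rn n → ℝ} {x : Rn n} (h : 1 < p x) :
    conjExp p x = ENNReal.ofReal (p x / (p x - 1)) := by
  have h1 : ENNReal.ofReal (p x) ≠ 1 := by
    rw [Ne, ENNReal.ofReal_eq_one]; exact h.ne'
  rw [conjExp, econj, if_neg h1, if_neg ENNReal.ofReal_ne_top,
    ENNReal.toReal_ofReal (by linarith)]

lemma one_div_conj {t : ℝ} (ht : 1 ≤ t) : 1 / (t / (t - 1)) = 1 - 1 / t := by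
  have : t ≠ 0 := by linarith
  rw [one_div_div]; field_simp

lemma LH0.conj {n : ℕ} {p : Rn n → ℝ} (h1 : ∀ x, 1 ≤ p x) (h : LH0 p) :
    LH0 fun x => p x / (p x - 1) := by
  obtain ⟨C, hC, h⟩ := h
  refine ⟨C, hC, fun x y hxy => ?_⟩
  rw [one_div_conj (h1 x), one_div_conj (h1 y),
    show 1 - 1 / p x - (1 - 1 / p y) = -(1 / p x - 1 / p y) by ring, abs_neg]
  exact h x y hxy

lemma LHinf.conj {n : ℕ} {p : Rn n → ℝ} (h1 : ∀ x, 1 ≤ p x) (h : LHinf p) :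
    ∃ C > 0, ∃ ρ : ℝ, ∀ x, |1 / (p x / (p x - 1)) - ρ| ≤ C / Real.log (Real.exp 1 + ‖x‖) := by
  obtain ⟨q, -, C, hC, h⟩ := h
  refine ⟨C, hC, 1 - 1 / q, fun x => ?_⟩
  rw [one_div_conj (h1 x),
    show 1 - 1 / p x - (1 - 1 / q) = -(1 / p x - 1 / q) by ring, abs_neg]
  exact h x

lemma LH0.of_inv_add {n : ℕ} {p₁ p₂ p : Rn n → ℝ} (hp : ∀ x, 1 / p x = 1 / p₁ x + 1 / p₂ x)
    (h₁ : LH0 p₁) (h₂ : LH0 p₂) : LH0 p := by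
  obtain ⟨C₁, hC₁, h₁⟩ := h₁
  obtain ⟨C₂, hC₂, h₂⟩ := h₂
  refine ⟨C₁ + C₂, by positivity, fun x y hxy => ?_⟩
  rw [hp, hp, add_sub_add_comm, add_div]
  exact (abs_add_le _ _).trans (add_le_add (h₁ x y hxy) (h₂ x y hxy))

lemma LHinf.of_inv_add {n : ℕ} {p₁ p₂ p : Rn n → ℝ} (hp : ∀ x, 1 / p x = 1 / p₁ x + 1 / p₂ x)
    (h₁ : LHinf p₁) (h₂ : LHinf p₂) :
    ∃ C > 0, ∃ ρ : ℝ, ∀ x, |1 / p x - ρ| ≤ C / Real.log (Real.exp 1 + ‖x‖) := by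
  obtain ⟨q₁, -, C₁, hC₁, h₁⟩ := h₁
  obtain ⟨q₂, -, C₂, hC₂, h₂⟩ := h₂
  refine ⟨C₁ + C₂, by positivity, 1 / q₁ + 1 / q₂, fun x => ?_⟩
  rw [hp, add_sub_add_comm, add_div]
  exact (abs_add_le _ _).trans (add_le_add (h₁ x) (h₂ x))

/-- if `(w₁,w₂,w) ∈ A_{p⃗(·)}` then `u = w^{p(·)}`,
`σ₁ = w₁^{-p₁'(·)}` and `σ₂ = w₂^{-p₂'(·)}` are `A_∞` weights. -/
theorem statement5 {n : ℕ} (p₁ p₂ p w₁ w₂ w : Rn n → ℝ)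
    (hp₁m : Measurable p₁) (hp₂m : Measurable p₂)
    (hp₁1 : ∀ x, 1 ≤ p₁ x) (hp₂1 : ∀ x, 1 ≤ p₂ x)
    (hp₁b : ∃ a b : ℝ, 1 < a ∧ ∀ᵐ x ∂(volume : Measure (Rn n)), a ≤ p₁ x ∧ p₁ x ≤ b)
    (hp₂b : ∃ a b : ℝ, 1 < a ∧ ∀ᵐ x ∂(volume : Measure (Rn n)), a ≤ p₂ x ∧ p₂ x ≤ b)
    (hp₁LH : LH p₁) (hp₂LH : LH p₂)
    (hp : ∀ x, 1 / p x = 1 / p₁ x + 1 / p₂ x)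
    (hw₁ : IsWeight w₁) (hw₂ : IsWeight w₂)
    (hw : ∀ x, w x = w₁ x * w₂ x)
    (hA : ApVec p₁ p₂ p w₁ w₂ w) :
    MuckAinf (fun x => w x ^ p x) ∧
      MuckAinf (fun x => w₁ x ^ (-(p₁ x / (p₁ x - 1)))) ∧
      MuckAinf (fun x => w₂ x ^ (-(p₂ x / (p₂ x - 1)))) := by
  obtain ⟨a₁, b₁, ha₁, hp₁b⟩ := hp₁b
  obtain ⟨a₂, b₂, ha₂, hp₂b⟩ := hp₂b
  obtain ⟨C, hC, hA⟩ := hA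
  obtain ⟨hw₁m, hw₁0⟩ := hw₁
  obtain ⟨hw₂m, hw₂0⟩ := hw₂
  have hpeq : p = fun x => 1 / (1 / p₁ x + 1 / p₂ x) := by
    funext x; rw [← hp x, one_div_one_div]
  have hwm : Measurable w := by
    rw [show w = fun x => w₁ x * w₂ x from funext hw]; fun_prop
  have hpm : Measurable p := by rw [hpeq]; fun_prop
  have hc₁m : Measurable fun x => p₁ x / (p₁ x - 1) := by fun_prop
  have hc₂m : Measurable fun x => p₂ x / (p₂ x - 1) := by fun_prop
  have hconj : ∀ {a t : ℝ}, 1 < a → a ≤ t →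
      1 < t / (t - 1) ∧ t / (t - 1) ≤ a / (a - 1) := by
    intro a t ha hat
    refine ⟨by rw [lt_div_iff₀ (by linarith)]; linarith, ?_⟩
    rw [div_le_div_iff₀ (by linarith) (by linarith)]
    nlinarith
  have hpb : ∀ᵐ x, 1 / 2 < p x ∧ p x ≤ max b₁ 1 := by
    filter_upwards [hp₁b, hp₂b] with x ⟨h1, h2⟩ ⟨h3, _⟩
    have i₁ : 0 < 1 / p₁ x := by apply one_div_pos.2; linarith
    have i₂ : 0 < 1 / p₂ x := by apply one_div_pos.2; linarith
    have j₁ : 1 / p₁ x < 1 := by rw [div_lt_one (by linarith)]; linarith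
    have j₂ : 1 / p₂ x < 1 := by rw [div_lt_one (by linarith)]; linarith
    rw [congrFun hpeq x]
    constructor
    · apply one_div_lt_one_div_of_lt <;> linarith
    · refine le_trans ?_ (h2.trans (le_max_left _ _))
      rw [div_le_iff₀ (by positivity)]
      have : p₁ x * (1 / p₁ x) = 1 := mul_one_div_cancel (by linarith)
      have : 0 < p₁ x * (1 / p₂ x) := mul_pos (by linarith) i₂
      linarith
  have hq₁b : ∀ᵐ x, 1 / 2 < p₁ x / (p₁ x - 1) ∧ p₁ x / (p₁ x - 1) ≤ a₁ / (a₁ - 1) :=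
    hp₁b.mono fun x hx => ⟨by linarith [(hconj ha₁ hx.1).1], (hconj ha₁ hx.1).2⟩
  have hq₂b : ∀ᵐ x, 1 / 2 < p₂ x / (p₂ x - 1) ∧ p₂ x / (p₂ x - 1) ≤ a₂ / (a₂ - 1) :=
    hp₂b.mono fun x hx => ⟨by linarith [(hconj ha₂ hx.1).1], (hconj ha₂ hx.1).2⟩
  have hw0 : ∀ᵐ x, 0 < w x := by
    filter_upwards [hw₁0, hw₂0] with x h1 h2
    rw [hw]; positivity
  have hsum : ∀ x, 1 / p x + 1 / (p₁ x / (p₁ x - 1)) + 1 / (p₂ x / (p₂ x - 1)) = 2 := by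
    intro x
    rw [one_div_conj (hp₁1 x), one_div_conj (hp₂1 x), hp]; ring
  have hlev := fun Q => exists_levels_of_product_le (Q := Q) (e₀ := p)
    (e₁ := fun x => p₁ x / (p₁ x - 1)) (e₂ := fun x => p₂ x / (p₂ x - 1))
    (.of_forall fun _ => rfl)
    (hp₁b.mono fun x hx => conjExp_eq_ofReal (by linarith))
    (hp₂b.mono fun x hx => conjExp_eq_ofReal (by linarith))
    (hpb.mono fun x hx => hx.1) (hq₁b.mono fun x hx => hx.1) (hq₂b.mono fun x hx => hx.1)
    hw0 (hw₁0.mono fun x hx => inv_pos.2 hx) (hw₂0.mono fun x hx => inv_pos.2 hx)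
    hpm hc₁m hc₂m hwm hw₁m.inv hw₂m.inv hC (hA Q)
  have hpos := hpb.and (hq₁b.and hq₂b)
  have hcongr : ∀ {v q : Rn n → ℝ}, (∀ᵐ x, 0 < v x) →
      MuckAinf (fun x => (v x)⁻¹ ^ q x) → MuckAinf fun x => v x ^ (-q x) := by
    rintro v q hv ⟨r, hr, C, hC, h⟩
    have hEq : ∀ᵐ x, (v x)⁻¹ ^ q x = v x ^ (-q x) := hv.mono fun x hx => by
      rw [Real.rpow_neg hx.le, Real.inv_rpow hx.le]
    refine ⟨r, hr, C, hC, fun Q => ?_⟩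
    have h1 : ∀ s : ℝ → ℝ, ∫⁻ x in Q.toSet, ENNReal.ofReal (s (v x ^ (-q x))) =
        ∫⁻ x in Q.toSet, ENNReal.ofReal (s ((v x)⁻¹ ^ q x)) := fun s =>
      lintegral_congr_ae (ae_restrict_of_ae (hEq.mono fun x hx => by simp only [hx]))
    have h2 := h1 id
    simp only [id] at h2
    rw [h2, h1 fun y => y ^ (1 - r / (r - 1))]
    exact h Q
  refine ⟨?_, hcongr hw₁0 ?_, hcongr hw₂0 ?_⟩
  · refine muckAinf_of_triple hwm hw₁m.inv hw₂m.inv hpm hc₁m hc₂m ?_ hpb (by positivity) ?_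
      (LH0.of_inv_add hp hp₁LH.1 hp₂LH.1) (LHinf.of_inv_add hp hp₁LH.2 hp₂LH.2) hlev
    · filter_upwards [hw₁0, hw₂0] with x h1 h2
      simp only [Pi.inv_apply]
      rw [hw]
      exact ⟨by positivity, by positivity, by positivity, by field_simp⟩
    · exact hpos.mono fun x hx => ⟨by linarith [hx.2.1.1], by linarith [hx.2.2.1], hsum x⟩
  · refine muckAinf_of_triple hw₁m.inv hwm hw₂m.inv hc₁m hpm hc₂m ?_ hq₁b
      (div_pos (by linarith) (by linarith)) ?_ (hp₁LH.1.conj hp₁1) (hp₁LH.2.conj hp₁1)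
      (A := 8 * C.toReal) fun Q => ?_
    · filter_upwards [hw₁0, hw₂0] with x h1 h2
      simp only [Pi.inv_apply]
      rw [hw]
      exact ⟨by positivity, by positivity, by positivity, by field_simp⟩
    · exact hpos.mono fun x hx =>
        ⟨by linarith [hx.1.1], by linarith [hx.2.2.1], by linarith [hsum x]⟩
    · obtain ⟨l₀, l₁, l₂, h₀, h₁, h₂, i₀, i₁, i₂, h⟩ := hlev Q
      exact ⟨l₁, l₀, l₂, h₁, h₀, h₂, i₁, i₀, i₂, by rwa [mul_comm l₁]⟩
  · refine muckAinf_of_triple hw₂m.inv hwm hw₁m.inv hc₂m hpm hc₁m ?_ hq₂b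
      (div_pos (by linarith) (by linarith)) ?_ (hp₂LH.1.conj hp₂1) (hp₂LH.2.conj hp₂1)
      (A := 8 * C.toReal) fun Q => ?_
    · filter_upwards [hw₁0, hw₂0] with x h1 h2
      simp only [Pi.inv_apply]
      rw [hw]
      exact ⟨by positivity, by positivity, by positivity, by field_simp⟩
    · exact hpos.mono fun x hx =>
        ⟨by linarith [hx.1.1], by linarith [hx.2.1.1], by linarith [hsum x]⟩
    · obtain ⟨l₀, l₁, l₂, h₀, h₁, h₂, i₀, i₁, i₂, h⟩ := hlev Q
      exact ⟨l₂, l₀, l₁, h₂, h₀, h₁, i₂, i₀, i₁, by linarith⟩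
end
end

section
/- Let p₁(·), p₂(·) : ℝⁿ → [1,∞) be measurable exponent functions, define p(·) by 1/p(x) = 1/p₁(x) + 1/p₂(x), and let w₁, w₂ be weights with w = w₁w₂. If w₁ ∈ A_{p₁(·)} and w₂ ∈ A_{p₂(·)}, then (w₁,w₂,w) ∈ A_{p⃗(·)}. -/
open MeasureTheory ENNReal Set

noncomputable section

theorem Cube.measurableSet_toSet_s10 {n : ℕ} (Q : Cube n) : MeasurableSet Q.toSet := by
  have h : Q.toSet = Set.univ.pi fun i => Set.Ico (Q.base i) (Q.base i + Q.side) := by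
    ext x
    simp [Cube.toSet]
  rw [h]
  exact MeasurableSet.univ_pi fun i => measurableSet_Ico

theorem eModular_ofExp {n : ℕ} (p : Rn n → ℝ) (hp : ∀ x, 0 ≤ p x) (μ : Measure (Rn n))
    (f : Rn n → ℝ≥0∞) (l : ℝ≥0∞) :
    eModular (ofExp p) μ f l = ∫⁻ x, (f x / l) ^ p x ∂μ := by
  simp [eModular, ofExp, ENNReal.toReal_ofReal (hp _)]

/-- An unweighted form of Young's inequality with exponents `1/p = 1/q + 1/r`. -/
theorem ENNReal.mul_rpow_le_rpow_add_rpow {p q r : ℝ} (hp : 0 < p) (hq : 0 < q) (hr : 0 < r)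
    (h : 1 / p = 1 / q + 1 / r) (a b : ℝ≥0∞) : (a * b) ^ p ≤ a ^ q + b ^ r := by
  have hsum : p / q + p / r = 1 := by
    field_simp at h ⊢
    linarith
  have ha : a ^ p = (a ^ q) ^ (p / q) := by
    rw [← ENNReal.rpow_mul, mul_div_cancel₀ _ hq.ne']
  have hb : b ^ p = (b ^ r) ^ (p / r) := by
    rw [← ENNReal.rpow_mul, mul_div_cancel₀ _ hr.ne']
  calc (a * b) ^ p = (a ^ q) ^ (p / q) * (b ^ r) ^ (p / r) := by
        rw [ENNReal.mul_rpow_of_nonneg _ _ hp.le, ha, hb]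
    _ ≤ (a ^ q + b ^ r) ^ (p / q) * (a ^ q + b ^ r) ^ (p / r) := by
        gcongr
        · exact le_self_add
        · exact le_add_self
    _ = a ^ q + b ^ r := by
        rw [← ENNReal.rpow_add_of_nonneg _ _ (by positivity) (by positivity), hsum,
          ENNReal.rpow_one]

/-- Hölder's inequality for variable exponents `1/p = 1/p₁ + 1/p₂`. -/
theorem eNorm_mul_le {n : ℕ} {p₁ p₂ p : Rn n → ℝ} (μ : Measure (Rn n))
    (hp₁m : Measurable p₁) (hp₁1 : ∀ x, 1 ≤ p₁ x) (hp₂1 : ∀ x, 1 ≤ p₂ x)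
    (hp : ∀ x, 1 / p x = 1 / p₁ x + 1 / p₂ x) {f g : Rn n → ℝ≥0∞} (hf : Measurable f)
    (hfN : eNorm (ofExp p₁) μ f ≠ ∞) (hgN : eNorm (ofExp p₂) μ g ≠ ∞) :
    eNorm (ofExp p) μ (fun x => f x * g x) ≤
      4 * (eNorm (ofExp p₁) μ f * eNorm (ofExp p₂) μ g) := by
  have hp₁0 : ∀ x, 0 < p₁ x := fun x => one_pos.trans_le (hp₁1 x)
  have hp₂0 : ∀ x, 0 < p₂ x := fun x => one_pos.trans_le (hp₂1 x)
  have hp0 : ∀ x, 0 < p x := fun x => by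
    rw [← one_div_pos, hp]
    have := hp₁0 x
    have := hp₂0 x
    positivity
  have hphalf : ∀ x, 1 / 2 ≤ p x := fun x => by
    have h₁ := div_le_one_of_le₀ (hp₁1 x) (hp₁0 x).le
    have h₂ := div_le_one_of_le₀ (hp₂1 x) (hp₂0 x).le
    have h : 1 / p x ≤ 2 := by rw [hp]; linarith
    rw [div_le_iff₀ (hp0 x)] at h
    linarith
  rw [← mul_assoc]
  have h4 : (4 : ℝ≥0∞) ≠ ∞ := by norm_num
  have key : ∀ l m : ℝ≥0∞, eNorm (ofExp p₁) μ f < l → eNorm (ofExp p₂) μ g < m →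
      eNorm (ofExp p) μ (fun x => f x * g x) ≤ 4 * (l * m) := by
    intro l' m' hl' hm'
    obtain ⟨l, ⟨hl0, hl⟩, hll⟩ := sInf_lt_iff.1 hl'
    obtain ⟨m, ⟨hm0, hm⟩, hmm⟩ := sInf_lt_iff.1 hm'
    have hlt : l ≠ ∞ := hll.ne_top
    have hmt : m ≠ ∞ := hmm.ne_top
    refine le_trans (sInf_le ⟨?_, ?_⟩) (by gcongr : 4 * (l * m) ≤ 4 * (l' * m'))
    · simp [hl0, hm0]
    rw [eModular_ofExp _ (fun x => (hp₁0 x).le)] at hl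
    rw [eModular_ofExp _ (fun x => (hp₂0 x).le)] at hm
    rw [eModular_ofExp _ (fun x => (hp0 x).le)]
    have pt : ∀ x, (f x * g x / (4 * (l * m))) ^ p x ≤
        2⁻¹ * ((f x / l) ^ p₁ x + (g x / m) ^ p₂ x) := by
      intro x
      have e : f x * g x / (4 * (l * m)) = 4⁻¹ * (f x / l * (g x / m)) := by
        simp only [div_eq_mul_inv]
        rw [ENNReal.mul_inv (Or.inl (by norm_num)) (Or.inl h4),
          ENNReal.mul_inv (Or.inl hl0) (Or.inl hlt)]
        ring
      have e4 : (4⁻¹ : ℝ≥0∞) ^ p x ≤ 2⁻¹ := by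
        calc (4⁻¹ : ℝ≥0∞) ^ p x ≤ 4⁻¹ ^ (1 / 2 : ℝ) :=
              ENNReal.rpow_le_rpow_of_exponent_ge (by simp [ENNReal.inv_le_one]) (hphalf x)
          _ = 2⁻¹ := by
              rw [show (4 : ℝ≥0∞) = 2 ^ (2 : ℝ) by norm_num, ← ENNReal.inv_rpow,
                ← ENNReal.rpow_mul]
              norm_num
      rw [e, ENNReal.mul_rpow_of_nonneg _ _ (hp0 x).le]
      gcongr
      exact ENNReal.mul_rpow_le_rpow_add_rpow (hp0 x) (hp₁0 x) (hp₂0 x) (hp x) _ _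
    calc ∫⁻ x, (f x * g x / (4 * (l * m))) ^ p x ∂μ
        ≤ ∫⁻ x, 2⁻¹ * ((f x / l) ^ p₁ x + (g x / m) ^ p₂ x) ∂μ := lintegral_mono pt
      _ = 2⁻¹ * (∫⁻ x, (f x / l) ^ p₁ x ∂μ + ∫⁻ x, (g x / m) ^ p₂ x ∂μ) := by
          rw [lintegral_const_mul' _ _ (by simp),
            lintegral_add_left ((hf.div_const l).pow hp₁m)]
      _ ≤ 2⁻¹ * (1 + 1) := by gcongr
      _ = 1 := by
          rw [one_add_one_eq_two]
          exact ENNReal.inv_mul_cancel (by simp) (by simp)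
  rw [mul_assoc, mul_comm, ← ENNReal.div_le_iff (by norm_num) h4]
  refine ENNReal.le_mul_of_forall_lt (Or.inr hgN) (Or.inl hfN) fun l hl m hm => ?_
  rw [ENNReal.div_le_iff (by norm_num) h4, mul_comm]
  exact key l m hl hm

/-- if `w₁ ∈ A_{p₁(·)}` and `w₂ ∈ A_{p₂(·)}` then
`(w₁,w₂,w₁w₂) ∈ A_{p⃗(·)}`. -/
theorem statement10 {n : ℕ} (p₁ p₂ p w₁ w₂ w : Rn n → ℝ)
    (hp₁m : Measurable p₁) (hp₂m : Measurable p₂)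
    (hp₁1 : ∀ x, 1 ≤ p₁ x) (hp₂1 : ∀ x, 1 ≤ p₂ x)
    (hp : ∀ x, 1 / p x = 1 / p₁ x + 1 / p₂ x)
    (hw₁ : IsWeight w₁) (hw₂ : IsWeight w₂)
    (hw : ∀ x, w x = w₁ x * w₂ x)
    (hA₁ : ApVarE (ofExp p₁) w₁) (hA₂ : ApVarE (ofExp p₂) w₂) :
    ApVec p₁ p₂ p w₁ w₂ w := by
  obtain ⟨C₁, hC₁, h₁⟩ := hA₁
  obtain ⟨C₂, hC₂, h₂⟩ := hA₂
  refine ⟨4 * (C₁ * C₂), by finiteness, fun Q => ?_⟩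
  specialize h₁ Q
  specialize h₂ Q
  change _ * _ * vNorm (conjExp p₁) _ ≤ _ at h₁
  change _ * _ * vNorm (conjExp p₂) _ ≤ _ at h₂
  set N₁' := vNorm (conjExp p₁) (Q.toSet.indicator fun x => (w₁ x)⁻¹)
  set N₂' := vNorm (conjExp p₂) (Q.toSet.indicator fun x => (w₂ x)⁻¹)
  have finite_left : ∀ {C N N' : ℝ≥0∞}, C ≠ ∞ → N' ≠ 0 → Q.vol⁻¹ * N * N' ≤ C → N ≠ ∞ := by
    rintro C N N' hC hN' h rfl
    have hv : Q.vol⁻¹ ≠ 0 := by simp [Cube.vol]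
    rw [ENNReal.mul_top hv, ENNReal.top_mul hN'] at h
    exact hC (top_le_iff.1 h)
  by_cases hN₁ : N₁' = 0
  · simp [hN₁]
  by_cases hN₂ : N₂' = 0
  · simp [hN₂]
  have hw' : (fun x => ENNReal.ofReal |Q.toSet.indicator w x|) = fun x =>
      ENNReal.ofReal |Q.toSet.indicator w₁ x| * ENNReal.ofReal |Q.toSet.indicator w₂ x| := by
    funext x
    rw [← ENNReal.ofReal_mul (abs_nonneg _), ← abs_mul]
    by_cases hx : x ∈ Q.toSet <;> simp [hx, hw]
  have holder : vNorm (ofExp p) (Q.toSet.indicator w) ≤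
      4 * (vNorm (ofExp p₁) (Q.toSet.indicator w₁) *
        vNorm (ofExp p₂) (Q.toSet.indicator w₂)) := by
    unfold vNorm
    rw [hw']
    refine eNorm_mul_le volume hp₁m hp₁1 hp₂1 hp ?_ (finite_left hC₁ hN₁ h₁)
      (finite_left hC₂ hN₂ h₂)
    have := hw₁.1.indicator Q.measurableSet_toSet_s10
    fun_prop
  calc _ ≤ Q.vol⁻¹ ^ 2 * (4 * (vNorm (ofExp p₁) (Q.toSet.indicator w₁) *
        vNorm (ofExp p₂) (Q.toSet.indicator w₂))) * N₁' * N₂' := by gcongr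
    _ = 4 * ((Q.vol⁻¹ * vNorm (ofExp p₁) (Q.toSet.indicator w₁) * N₁') *
        (Q.vol⁻¹ * vNorm (ofExp p₂) (Q.toSet.indicator w₂) * N₂')) := by ring
    _ ≤ 4 * (C₁ * C₂) := by gcongr
end
end
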